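/- Let N ≥ 2, r > 0, δ ∈ πrℤ, 0 < t < t* < ∞. Let u = (u_1,…,u_N) ∈ ℝ^N satisfy 0 ≤ u_1 < u_2 < ⋯ < u_N < 2πr and ū_δ := δ + Σ_{j=1}^N u_j ∈ (0, 2πr). Then for every w = (w_1,…,w_N) ∈ ℝ^N: det_{1≤j,k≤N}[ M^A_{u,δ,k}(t, w_j) ] = h_N^A(t* − t, w) / h_N^A(t*, u). -/

import Mathlib

/-- The Jacobi theta function
`ϑ1(v;τ) = i ∑_{n ∈ ℤ} (-1)^n e^{iπτ(n-1/2)^2} e^{iπ(2n-1)v}`. -/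
noncomputable def theta1 (v τ : ℂ) : ℂ :=
  Complex.I * ∑' n : ℤ, (-1 : ℂ) ^ n *
    Complex.exp (Real.pi * Complex.I * τ * ((n : ℂ) - 1 / 2) ^ 2) *
    Complex.exp (Real.pi * Complex.I * (2 * (n : ℂ) - 1) * v)

/-- The entire function `Φ^A_{u,δ,k}(z)` built from Jacobi theta functions with
nome parameter `τ = i N t* / (2π r²)`. -/
noncomputable def PhiA (N : ℕ) (r tstar : ℝ) (u : Fin N → ℝ) (δ : ℝ) (k : Fin N)
    (z : ℂ) : ℂ :=
  theta1 ((((δ + ∑ i, u i : ℝ) : ℂ) + z - ((u k : ℝ) : ℂ)) / (2 * Real.pi * r))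
      (Complex.I * N * tstar / (2 * Real.pi * r ^ 2)) /
    theta1 (((δ + ∑ i, u i : ℝ) : ℂ) / (2 * Real.pi * r))
      (Complex.I * N * tstar / (2 * Real.pi * r ^ 2)) *
  ∏ ℓ ∈ Finset.univ.erase k,
    theta1 ((z - ((u ℓ : ℝ) : ℂ)) / (2 * Real.pi * r))
        (Complex.I * N * tstar / (2 * Real.pi * r ^ 2)) /
      theta1 ((((u k - u ℓ) : ℝ) : ℂ) / (2 * Real.pi * r))
        (Complex.I * N * tstar / (2 * Real.pi * r ^ 2))

/-- `M^A_{u,δ,k}(t,x) = ∫_ℝ (e^{-w²/(2t)}/√(2πt)) Φ^A_{u,δ,k}(x + iw) dw`. -/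
noncomputable def MA (N : ℕ) (r tstar : ℝ) (u : Fin N → ℝ) (δ : ℝ) (k : Fin N)
    (t x : ℝ) : ℂ :=
  ∫ w : ℝ, ((Real.exp (-w ^ 2 / (2 * t)) / Real.sqrt (2 * Real.pi * t) : ℝ) : ℂ) *
    PhiA N r tstar u δ k ((x : ℂ) + Complex.I * w)

/-- The function `h_N^A(s, x)` of the paper. -/
noncomputable def hA (N : ℕ) (r tstar δ : ℝ) (s : ℝ) (x : Fin N → ℝ) : ℂ :=
  ((Real.exp (-((N : ℝ) * ((N : ℝ) - 1) * ((N : ℝ) - 2) * tstar) / (48 * r ^ 2)) : ℝ) : ℂ) *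
    ((Real.exp (-((N : ℝ) * s) / (24 * r ^ 2)) *
        ∏' n : ℕ, (1 - Real.exp (-(((n : ℝ) + 1) * N * s) / r ^ 2)) : ℝ) : ℂ) ^
      (-((((N - 1) * (N - 2) / 2 : ℕ)) : ℤ)) *
    theta1 ((((δ + ∑ j, x j) / (2 * Real.pi * r) : ℝ)) : ℂ)
      (Complex.I * N * s / (2 * Real.pi * r ^ 2)) *
    ∏ j : Fin N, ∏ k : Fin N, if j < k then
      theta1 ((((x k - x j) / (2 * Real.pi * r) : ℝ)) : ℂ)
        (Complex.I * N * s / (2 * Real.pi * r ^ 2)) else 1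


/-- finite q-Pochhammer `(q;q)_n` -/
noncomputable def qp (q : ℂ) (n : ℕ) : ℂ := ∏ i ∈ Finset.range n, (1 - q ^ (i + 1))

lemma qp_succ (q : ℂ) (n : ℕ) : qp q (n + 1) = qp q n * (1 - q ^ (n + 1)) := by
  simp [qp, Finset.prod_range_succ]

lemma one_sub_pow_ne {q : ℂ} (hq : ‖q‖ < 1) (n : ℕ) : 1 - q ^ (n + 1) ≠ 0 := by
  intro h
  have h1 : q ^ (n + 1) = 1 := (sub_eq_zero.mp h).symm
  have h2 : ‖q‖ ^ (n + 1) = 1 := by rw [← norm_pow, h1, norm_one]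
  have h3 : ‖q‖ ^ (n + 1) < 1 := pow_lt_one₀ (norm_nonneg _) hq (by omega)
  linarith

lemma qp_ne {q : ℂ} (hq : ‖q‖ < 1) (n : ℕ) : qp q n ≠ 0 :=
  Finset.prod_ne_zero_iff.mpr fun i _ => one_sub_pow_ne hq i

lemma qbinom {q : ℂ} (hq : ‖q‖ < 1) (y : ℂ) (m : ℕ) :
    ∏ i ∈ Finset.range m, (1 + y * q ^ i) =
      ∑ j ∈ Finset.range (m + 1), q ^ (j.choose 2) * (qp q m / (qp q j * qp q (m - j))) * y ^ j := by
  induction m with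
  | zero => simp [qp]
  | succ m ih =>
    rw [Finset.prod_range_succ, ih, mul_add, mul_one, Finset.sum_range_succ' _ (m + 1)]
    conv_rhs => rw [Finset.sum_range_succ _ m]
    conv_lhs => 
      congr
      · rw [Finset.sum_range_succ' _ m]
      · rw [Finset.sum_range_succ _ m, add_mul]
    have key : ∀ j ∈ Finset.range m,
        q ^ ((j+1).choose 2) * (qp q (m+1) / (qp q (j+1) * qp q (m + 1 - (j+1)))) * y ^ (j+1) =
        q ^ ((j+1).choose 2) * (qp q m / (qp q (j+1) * qp q (m - (j+1)))) * y ^ (j+1) +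
        q ^ (j.choose 2) * (qp q m / (qp q j * qp q (m - j))) * y ^ j * (y * q ^ m) := by
      intro j hj
      obtain ⟨d, rfl⟩ := Nat.exists_eq_add_of_lt (Finset.mem_range.mp hj)
      have e1 : j + d + 1 + 1 - (j + 1) = d + 1 := by omega
      have e2 : j + d + 1 - (j + 1) = d := by omega
      have e3 : j + d + 1 - j = d + 1 := by omega
      have e4 : (j + 1).choose 2 = j.choose 2 + j := by
        rw [Nat.choose_succ_succ' j 1]; simp [add_comm]
      rw [e1, e2, e3, e4, qp_succ q (j + d + 1), qp_succ q j, qp_succ q d]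
      have h1 := qp_ne hq j
      have h2 := qp_ne hq d
      have h3 := one_sub_pow_ne hq j
      have h4 := one_sub_pow_ne hq d
      field_simp
      ring
    rw [Finset.sum_congr rfl key, Finset.sum_add_distrib, Finset.sum_mul]
    have h0 := qp_ne hq m
    have h1 := qp_ne hq (m+1)
    have e4 : (m + 1).choose 2 = m.choose 2 + m := by
        rw [Nat.choose_succ_succ' m 1]; simp [add_comm]
    have q0 : qp q 0 = 1 := by simp [qp]
    rw [e4]
    simp only [Nat.sub_self, q0, Nat.sub_zero, mul_one, one_mul, div_self h0, div_self h1]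
    ring

lemma tprod_tendsto {q : ℂ} (hq : ‖q‖ < 1) (x : ℂ) :
    Filter.Tendsto (fun n => ∏ i ∈ Finset.range n, (1 + x * q ^ i)) Filter.atTop
      (nhds (∏' i : ℕ, (1 + x * q ^ i))) := by
  apply (Multipliable.hasProd _).tendsto_prod_nat
  apply multipliable_one_add_of_summable
  simp only [norm_mul, norm_pow]
  exact (summable_geometric_of_lt_one (norm_nonneg _) hq).mul_left _

lemma tprod_ne {q : ℂ} (hq : ‖q‖ < 1) (x : ℂ) (hx : ∀ i : ℕ, 1 + x * q ^ i ≠ 0) :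
    ∏' i : ℕ, (1 + x * q ^ i) ≠ 0 := by
  apply tprod_one_add_ne_zero_of_summable hx
  simp only [norm_mul, norm_pow]
  exact (summable_geometric_of_lt_one (norm_nonneg _) hq).mul_left _

/-- `(q;q)_∞` -/
noncomputable def qinf (q : ℂ) : ℂ := ∏' i : ℕ, (1 - q ^ (i + 1))

lemma qinf_eq (q : ℂ) : qinf q = ∏' i : ℕ, (1 + (-q) * q ^ i) := by
  unfold qinf; congr 1; funext i; ring

lemma qinf_ne {q : ℂ} (hq : ‖q‖ < 1) : qinf q ≠ 0 := by
  rw [qinf_eq]; apply tprod_ne hq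
  intro i; convert one_sub_pow_ne hq i using 1; ring

lemma qp_tendsto {q : ℂ} (hq : ‖q‖ < 1) :
    Filter.Tendsto (qp q) Filter.atTop (nhds (qinf q)) := by
  rw [qinf_eq]; convert tprod_tendsto hq (-q) using 1
  funext n; unfold qp; congr 1; funext i; ring

/-- finite coefficient -/
noncomputable def jc (q : ℂ) (n : ℕ) (k : ℤ) : ℂ :=
  if -(n:ℤ) ≤ k ∧ k ≤ n then qp q (2 * n) / (qp q (n + k).toNat * qp q (n - k).toNat) else 0

lemma zchoose (n j : ℕ) : (((j:ℤ) - n) * ((j:ℤ) - n - 1) / 2) =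
    (j.choose 2 : ℤ) - n * j + (n * (n + 1) / 2 : ℕ) := by
  have h1 : ((j.choose 2 : ℕ) : ℤ) * 2 = j * (j - 1) := by
    cases j with
    | zero => simp
    | succ j => 
      have := Nat.triangle_succ j
      rw [Nat.choose_two_right]
      have h := Nat.div_mul_cancel (Nat.even_mul_pred_self (j+1)).two_dvd
      zify at h
      push_cast at h ⊢
      rw [h]; simp 
  have h2 : ((n * (n + 1) / 2 : ℕ) : ℤ) * 2 = n * (n + 1) := by
    have h := Nat.div_mul_cancel (Nat.even_mul_succ_self n).two_dvd
    exact_mod_cast h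
  apply Int.ediv_eq_of_eq_mul_left (by norm_num)
  linear_combination (norm := ring_nf) -h1 - h2

lemma jtp_fin {q : ℂ} (hq : ‖q‖ < 1) (hq0 : q ≠ 0) {x : ℂ} (hx : x ≠ 0) (n : ℕ) :
    ∑' k : ℤ, jc q n k * (q ^ (k * (k - 1) / 2) * x ^ k) =
      (∏ i ∈ Finset.range n, (1 + x * q ^ i)) * ∏ i ∈ Finset.range n, (1 + (x⁻¹ * q) * q ^ i) := by
  have hb := qbinom hq (x * (q ^ n)⁻¹) (2 * n)
  rw [two_mul, Finset.prod_range_add] at hb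
  have e1 : ∏ i ∈ Finset.range n, (1 + x * (q ^ n)⁻¹ * q ^ (n + i)) =
      ∏ i ∈ Finset.range n, (1 + x * q ^ i) := by
    apply Finset.prod_congr rfl
    intro i _
    rw [pow_add]; field_simp
  have e2 : ∏ i ∈ Finset.range n, (1 + x * (q ^ n)⁻¹ * q ^ i) =
      (x ^ n * (q ^ (n * (n + 1) / 2))⁻¹) * ∏ i ∈ Finset.range n, (1 + (x⁻¹ * q) * q ^ i) := by
    have : n * (n + 1) / 2 = ∑ i ∈ Finset.range n, (i + 1) := by
      rw [Finset.sum_add_distrib, Finset.sum_range_id]; simp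
      have h := Nat.div_mul_cancel (Nat.even_mul_succ_self n).two_dvd
      have h' := Nat.div_mul_cancel (Nat.even_mul_pred_self n).two_dvd
      cases n with
      | zero => simp
      | succ n => simp at h h' ⊢; nlinarith
    rw [this, ← Finset.prod_pow_eq_pow_sum, ← Finset.prod_inv_distrib]
    conv_rhs => rw [← Finset.card_range n, ← Finset.prod_const, Finset.card_range]
    rw [← Finset.prod_mul_distrib, ← Finset.prod_mul_distrib, ← Finset.prod_range_reflect]
    apply Finset.prod_congr rfl
    intro i hi
    have hi := Finset.mem_range.mp hi
    have : q ^ n = q ^ (n - 1 - i) * q ^ (i + 1) := by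
      rw [← pow_add]; congr 1; omega
    rw [this]
    field_simp
    ring
  rw [e1, e2] at hb
  have e3 : ∑' k : ℤ, jc q n k * (q ^ (k * (k - 1) / 2) * x ^ k) =
      ∑ j ∈ Finset.range (2 * n + 1), jc q n (j - n) *
        (q ^ (((j:ℤ) - n) * ((j:ℤ) - n - 1) / 2) * x ^ ((j:ℤ) - n)) := by
    rw [tsum_eq_sum (s := Finset.image (fun j : ℕ => (j:ℤ) - n) (Finset.range (2 * n + 1)))]
    · rw [Finset.sum_image]
      intro a _ b _ h
      simp at h; exact h
    · intro k hk
      have : ¬ (-(n:ℤ) ≤ k ∧ k ≤ n) := by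
        intro h
        apply hk
        simp only [Finset.mem_image, Finset.mem_range]
        exact ⟨(k + n).toNat, by omega, by omega⟩
      simp [jc, this]
  rw [e3]
  have e4 : (∏ i ∈ Finset.range n, (1 + x * q ^ i)) * ∏ i ∈ Finset.range n, (1 + (x⁻¹ * q) * q ^ i)
     = ((x ^ n)⁻¹ * (q ^ (n * (n + 1) / 2))) *  (x ^ n * (q ^ (n * (n + 1) / 2))⁻¹ * (∏ i ∈ Finset.range n, (1 + x⁻¹ * q * q ^ i)) * ∏ i ∈ Finset.range n, (1 + x * q ^ i)) := by
    field_simp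
  rw [e4, hb, Finset.mul_sum, ← two_mul]
  apply Finset.sum_congr rfl
  intro j hj
  have hj := Finset.mem_range.mp hj
  have hc : -(n:ℤ) ≤ (j:ℤ) - n ∧ (j:ℤ) - n ≤ n := by omega
  have t1 : ((n:ℤ) + ((j:ℤ) - n)).toNat = j := by omega
  have t2 : ((n:ℤ) - ((j:ℤ) - n)).toNat = 2 * n - j := by omega
  rw [jc, if_pos hc, t1, t2, zchoose, zpow_add₀ hq0, zpow_sub₀ hq0, zpow_sub₀ hx]
  rw [zpow_natCast, zpow_natCast, zpow_natCast, zpow_natCast]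
  rw [show ((n:ℤ) * j) = ((n * j : ℕ) : ℤ) by push_cast; ring, zpow_natCast, mul_pow, inv_pow, ← pow_mul]
  have h1 := qp_ne hq j
  have h2 := qp_ne hq (2 * n - j)
  field_simp

theorem jtp {q : ℂ} (hq : ‖q‖ < 1) (hq0 : q ≠ 0) {x : ℂ} (hx : x ≠ 0)
    (hs : Summable fun k : ℤ => q ^ (k * (k - 1) / 2) * x ^ k) :
    ∑' k : ℤ, q ^ (k * (k - 1) / 2) * x ^ k =
      qinf q * (∏' i : ℕ, (1 + x * q ^ i)) * ∏' i : ℕ, (1 + (x⁻¹ * q) * q ^ i) := by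
  have hQ := qinf_ne hq
  obtain ⟨B, hB⟩ := (Metric.isBounded_range_of_tendsto _ (qp_tendsto hq)).exists_norm_le
  obtain ⟨B', hB'⟩ := (Metric.isBounded_range_of_tendsto _ ((qp_tendsto hq).inv₀ hQ)).exists_norm_le
  have hB : ∀ n, ‖qp q n‖ ≤ B := fun n => hB _ ⟨n, rfl⟩
  have hB' : ∀ n, ‖(qp q n)⁻¹‖ ≤ B' := fun n => hB' _ ⟨n, rfl⟩
  have B0 : 0 ≤ B := (norm_nonneg _).trans (hB 0)
  have B0' : 0 ≤ B' := (norm_nonneg _).trans (hB' 0)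
  have L : Filter.Tendsto (fun n => ∑' k : ℤ, jc q n k * (q ^ (k * (k - 1) / 2) * x ^ k)) Filter.atTop
      (nhds (∑' k : ℤ, (qinf q)⁻¹ * (q ^ (k * (k - 1) / 2) * x ^ k))) := by
    apply tendsto_tsum_of_dominated_convergence
      (bound := fun k : ℤ => B * (B' * B') * ‖q ^ (k * (k - 1) / 2) * x ^ k‖)
    · exact hs.norm.mul_left _
    · intro k
      apply Filter.Tendsto.mul_const
      have : Filter.Tendsto (fun n : ℕ => qp q (2 * n) / (qp q (n + k).toNat * qp q (n - k).toNat))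
          Filter.atTop (nhds (qinf q / (qinf q * qinf q))) := by
        apply Filter.Tendsto.div _ _ (mul_ne_zero hQ hQ)
        · apply (qp_tendsto hq).comp
          apply Filter.tendsto_atTop_mono (f := fun n : ℕ => n) (fun n => by omega) Filter.tendsto_id
        · apply Filter.Tendsto.mul
          · apply (qp_tendsto hq).comp
            apply Filter.tendsto_atTop_atTop.mpr
            intro b; exact ⟨b + k.natAbs, fun a ha => by omega⟩
          · apply (qp_tendsto hq).comp
            apply Filter.tendsto_atTop_atTop.mpr
            intro b; exact ⟨b + k.natAbs, fun a ha => by omega⟩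
      rw [show qinf q / (qinf q * qinf q) = (qinf q)⁻¹ by field_simp] at this
      apply this.congr'
      filter_upwards [Filter.eventually_ge_atTop k.natAbs] with n hn
      rw [jc, if_pos (by omega)]
    · apply Filter.Eventually.of_forall
      intro n k
      rw [norm_mul]
      apply mul_le_mul_of_nonneg_right _ (norm_nonneg _)
      unfold jc
      split_ifs
      · rw [div_eq_mul_inv, mul_inv, norm_mul, norm_mul]
        gcongr
        · exact hB _
        · exact hB' _
        · exact hB' _
      · simp; positivity
  have L2 := (tprod_tendsto hq x).mul (tprod_tendsto hq (x⁻¹ * q))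
  simp_rw [jtp_fin hq hq0 hx] at L
  have := tendsto_nhds_unique L L2
  rw [tsum_mul_left] at this
  rw [mul_assoc, ← this]
  field_simp
open Complex in
/-- terms of the basis theta series -/
noncomputable def gT (N : ℕ) (m : ℤ) (a : ℕ) (τ v : ℂ) (n : ℤ) : ℂ :=
  ((-1 : ℂ) ^ ((N : ℤ) + m)) ^ n *
    exp (Real.pi * I * τ * ((a : ℂ) - N / 2 + n * N) ^ 2 / N +
      2 * Real.pi * I * ((a : ℂ) - N / 2 + n * N) * v)

/-- basis theta series -/
noncomputable def gS (N : ℕ) (m : ℤ) (a : ℕ) (τ v : ℂ) : ℂ := ∑' n : ℤ, gT N m a τ v n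

lemma theta1_eq_gS (v τ : ℂ) : theta1 v τ = Complex.I * gS 1 0 0 τ v := by
  unfold theta1 gS gT
  congr 1
  apply tsum_congr
  intro n
  rw [mul_assoc, ← Complex.exp_add]
  congr 1
  · simp
  · congr 1; push_cast; ring

lemma negone_zpow (k : ℤ) : (-1 : ℂ) ^ k = Complex.exp (Real.pi * Complex.I * k) := by
  rw [← Complex.exp_pi_mul_I, ← Complex.exp_int_mul]; ring_nf

lemma gT_eq (N : ℕ) (hN : N ≠ 0) (m : ℤ) (a : ℕ) (τ v : ℂ) (n : ℤ) : gT N m a τ v n =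
    Complex.exp (Real.pi * Complex.I * τ * ((a : ℂ) - N / 2) ^ 2 / N +
      2 * Real.pi * Complex.I * ((a : ℂ) - N / 2) * v) *
    jacobiTheta₂_term n (N * v + (a - N / 2) * τ + (N + m) / 2) (N * τ) := by
  have hN' : (N : ℂ) ≠ 0 := by exact_mod_cast hN
  unfold gT jacobiTheta₂_term
  rw [← zpow_mul, negone_zpow, ← Complex.exp_add, ← Complex.exp_add]
  congr 1
  push_cast
  field_simp
  ring

lemma gT_summable (N : ℕ) (hN : N ≠ 0) (m : ℤ) (a : ℕ) {τ : ℂ} (hτ : 0 < τ.im) (v : ℂ) :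
    Summable (gT N m a τ v) := by
  have : gT N m a τ v = _ := funext (gT_eq N hN m a τ v)
  rw [this]
  apply Summable.mul_left
  rw [summable_jacobiTheta₂_term_iff]
  simp only [Complex.mul_im, Complex.natCast_re, Complex.natCast_im, zero_mul, add_zero]
  exact mul_pos (Nat.cast_pos.mpr (Nat.pos_of_ne_zero hN)) hτ

lemma gT_eq' (N : ℕ) (hN : N ≠ 0) (m : ℤ) (a : ℕ) (τ v : ℂ) (n : ℤ) : gT N m a τ v n =
    Complex.exp (Real.pi * Complex.I * τ * ((a : ℂ) - N / 2) ^ 2 / N +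
      2 * Real.pi * Complex.I * ((a : ℂ) - N / 2) * v) *
    (Complex.exp (2 * Real.pi * Complex.I * (N * τ)) ^ (n * (n - 1) / 2) *
     ((-1 : ℂ) ^ ((N : ℤ) + m) * Complex.exp (2 * Real.pi * Complex.I * (a * τ + N * v))) ^ n) := by
  have hN' : (N : ℂ) ≠ 0 := by exact_mod_cast hN
  unfold gT
  rw [mul_zpow, ← Complex.exp_int_mul, ← Complex.exp_int_mul]
  have h : (((n * (n - 1) / 2 : ℤ)) : ℂ) = n * (n - 1) / 2 := by
    have h := Int.ediv_mul_cancel (Int.even_mul_pred_self n).two_dvd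
    have h' : (((n * (n - 1) / 2 : ℤ)) : ℂ) * 2 = n * (n - 1) := by exact_mod_cast h
    rw [← h']; ring
  rw [h]
  rw [show ∀ A B C D : ℂ, A * (B * (C * D)) = C * (A * (B * D)) by intros; ring]
  rw [← Complex.exp_add, ← Complex.exp_add]
  congr 2
  field_simp
  ring

lemma norm_q_lt {τ : ℂ} (hτ : 0 < τ.im) : ‖Complex.exp (2 * Real.pi * Complex.I * τ)‖ < 1 := by
  rw [Complex.norm_exp]
  simp
  positivity

theorem gS_jtp (N : ℕ) (hN : N ≠ 0) (m : ℤ) (a : ℕ) {τ : ℂ} (hτ : 0 < τ.im) (v : ℂ)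
    (X Q : ℂ) (hX : X = (-1 : ℂ) ^ ((N : ℤ) + m) * Complex.exp (2 * Real.pi * Complex.I * (a * τ + N * v)))
    (hQ : Q = Complex.exp (2 * Real.pi * Complex.I * (N * τ))) :
    gS N m a τ v =
    Complex.exp (Real.pi * Complex.I * τ * ((a : ℂ) - N / 2) ^ 2 / N +
      2 * Real.pi * Complex.I * ((a : ℂ) - N / 2) * v) *
    (qinf Q * (∏' i : ℕ, (1 + X * Q ^ i)) * ∏' i : ℕ, (1 + (X⁻¹ * Q) * Q ^ i)) := by
  have hs := gT_summable N hN m a hτ v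
  unfold gS
  rw [funext (gT_eq' N hN m a τ v)] at hs ⊢
  rw [summable_mul_left_iff (Complex.exp_ne_zero _)] at hs
  rw [tsum_mul_left, ← hQ, ← hX]
  rw [← hQ, ← hX] at hs
  congr 1
  apply jtp _ _ _ hs
  · rw [hQ]; apply norm_q_lt
    simp only [Complex.mul_im, Complex.natCast_re, Complex.natCast_im, zero_mul, add_zero]
    exact mul_pos (Nat.cast_pos.mpr (Nat.pos_of_ne_zero hN)) hτ
  · rw [hQ]; exact Complex.exp_ne_zero _
  · rw [hX]; apply mul_ne_zero _ (Complex.exp_ne_zero _); exact zpow_ne_zero _ (by norm_num)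

theorem theta1_prod {τ : ℂ} (hτ : 0 < τ.im) (v : ℂ)
    (x q : ℂ) (hx : x = Complex.exp (2 * Real.pi * Complex.I * v))
    (hq : q = Complex.exp (2 * Real.pi * Complex.I * τ)) :
    theta1 v τ = Complex.I * Complex.exp (Real.pi * Complex.I * τ / 4 - Real.pi * Complex.I * v) *
      (qinf q * (∏' i : ℕ, (1 + (-x) * q ^ i)) * ∏' i : ℕ, (1 + ((-x)⁻¹ * q) * q ^ i)) := by
  rw [theta1_eq_gS, gS_jtp 1 one_ne_zero 0 0 hτ v (-x) q (by simp [hx]) (by simp [hq]), ← mul_assoc]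
  congr 3
  push_cast
  ring

lemma theta1_neg (v τ : ℂ) : theta1 (-v) τ = - theta1 v τ := by
  unfold theta1
  rw [← mul_neg, ← tsum_neg, ← (Equiv.subLeft (1:ℤ)).tsum_eq]
  congr 1
  apply tsum_congr
  intro n
  simp only [Equiv.subLeft_apply]
  rw [zpow_sub₀ (by norm_num), zpow_one, ← neg_mul, ← neg_mul]
  congr 1
  · congr 1
    · rw [neg_eq_neg_one_mul]
      rcases Int.even_or_odd n with h | h
      · simp [h.neg_one_zpow]
      · simp [h.neg_one_zpow]
    · congr 1; push_cast; ring
  · congr 1; push_cast; ring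

lemma theta1_zero (τ : ℂ) : theta1 0 τ = 0 := by
  have := theta1_neg 0 τ
  rw [neg_zero] at this
  exact self_eq_neg.mp this

lemma theta1_ne {τ : ℂ} (hτ : 0 < τ.im) (v : ℝ) (hv : ∀ n : ℤ, v ≠ n) : theta1 v τ ≠ 0 := by
  rw [theta1_prod hτ v _ _ rfl rfl]
  have hq := norm_q_lt hτ
  set q := Complex.exp (2 * Real.pi * Complex.I * τ)
  set x := Complex.exp (2 * Real.pi * Complex.I * v) with hx
  have hxn : ‖x‖ = 1 := by
    rw [hx, Complex.norm_exp]; simp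
  have hx1 : x ≠ 1 := by
    rw [hx, Ne, Complex.exp_eq_one_iff]
    rintro ⟨n, hn⟩
    apply hv n
    have h2 : (2 * Real.pi * Complex.I) ≠ 0 := Complex.two_pi_I_ne_zero
    have : (v : ℂ) = n := by
      apply mul_left_cancel₀ h2; rw [hn]; ring
    exact_mod_cast this
  have hn0 : ∀ i : ℕ, ∀ y : ℂ, ‖y‖ = 1 → 1 + y * q ^ (i+1) ≠ 0 := by
    intro i y hy h
    have h1 : y * q ^ (i+1) = -1 := by linear_combination h
    have h2 : ‖q‖ ^ (i + 1) = 1 := by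
      have := congrArg norm h1
      simpa [hy] using this
    have h3 : ‖q‖ ^ (i + 1) < 1 := pow_lt_one₀ (norm_nonneg _) hq (by omega)
    linarith
  refine mul_ne_zero (mul_ne_zero Complex.I_ne_zero (Complex.exp_ne_zero _))
    (mul_ne_zero (mul_ne_zero (qinf_ne hq) (tprod_ne hq _ ?_)) (tprod_ne hq _ ?_))
  · intro i
    cases i with
    | zero =>
      simp; intro h; apply hx1; linear_combination -h
    | succ i => exact hn0 i (-x) (by simp [hxn])
  · intro i
    have := hn0 i (-x)⁻¹ (by simp [hxn])
    rw [pow_succ] at this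
    convert this using 2; ring


lemma HasSum.congr_fun' {ι : Type*} {f g : ι → ℂ} {a : ℂ} (h : HasSum g a) (hfg : ∀ i, f i = g i) :
    HasSum f a := by
  rw [funext hfg]; exact h

lemma HasSum.congr_val' {ι : Type*} {f : ι → ℂ} {a b : ℂ} (h : HasSum f a) (hab : b = a) :
    HasSum f b := by
  rw [hab]; exact h

/-- theta functions of order `N` with characteristic `s` -/
def IsT (τ : ℂ) (N : ℕ) (s : ℂ) (f : ℂ → ℂ) : Prop :=
  ∃ c : ℤ → ℂ, (∀ v, HasSum (fun n : ℤ => c n * Complex.exp (2 * Real.pi * Complex.I * (n - N / 2) * v)) (f v)) ∧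
    ∀ n, c (n + N) = (-1) ^ N * Complex.exp (2 * Real.pi * Complex.I * (s + τ * n)) * c n

lemma IsT_one (τ : ℂ) : IsT τ 0 0 (fun _ => 1) := by
  refine ⟨fun n => if n = 0 then 1 else 0, fun v => ?_, fun n => ?_⟩
  · convert hasSum_ite_eq (0:ℤ) (1:ℂ) using 1
    funext n
    split_ifs with h <;> simp [h]
  · by_cases h : n = 0 <;> simp [h]

lemma IsT_theta {τ : ℂ} (hτ : 0 < τ.im) (a : ℂ) : IsT τ 1 a (fun v => theta1 (v + a) τ) := by
  refine ⟨fun n => Complex.I * ((-1) ^ n * Complex.exp (Real.pi * Complex.I * τ * (n - 1 / 2) ^ 2 +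
    2 * Real.pi * Complex.I * (n - 1 / 2) * a)), fun v => ?_, fun n => ?_⟩
  · dsimp only
    rw [theta1_eq_gS]
    have h := (gT_summable 1 one_ne_zero 0 0 hτ (v + a)).hasSum.mul_left Complex.I
    refine HasSum.congr_fun' h (fun n => ?_)
    rw [gT, mul_assoc, mul_assoc, ← Complex.exp_add]
    congr 2
    · simp
    · congr 1; push_cast; ring
  · dsimp only
    rw [zpow_add₀ (by norm_num), pow_one]
    rw [show ∀ A B C D E : ℂ, A * B * (C * (D * E)) = C * (D * A * (B * E)) by intros; ring]
    rw [← Complex.exp_add]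
    congr 2
    · simp
    · congr 1; push_cast; ring

lemma IsT_mul {τ : ℂ} {N M : ℕ} {s s' : ℂ} {f g : ℂ → ℂ} (hf : IsT τ N s f) (hg : IsT τ M s' g) :
    IsT τ (N + M) (s + s') (fun v => f v * g v) := by
  obtain ⟨c, hc, hc'⟩ := hf
  obtain ⟨d, hd, hd'⟩ := hg
  refine ⟨fun n => ∑' k : ℤ, c k * d (n - k), fun v => ?_, fun n => ?_⟩
  · have hs := summable_mul_of_summable_norm (hc v).summable.norm (hd v).summable.norm
    have h := hs.hasSum
    rw [← tsum_mul_tsum_of_summable_norm (hc v).summable.norm (hd v).summable.norm,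
      (hc v).tsum_eq, (hd v).tsum_eq] at h
    let e : ℤ × ℤ ≃ ℤ × ℤ :=
      ⟨fun p => (p.2, p.1 - p.2), fun p => (p.1 + p.2, p.1), fun p => by simp, fun p => by simp⟩
    have h2 := e.hasSum_iff.mpr h
    refine h2.prod_fiberwise fun n => ?_
    have h3 := (h2.summable.prod_factor n).hasSum
    rw [← tsum_mul_right]
    refine (h3.congr_val' (tsum_congr fun k => ?_))
    simp only [Function.comp, e, Equiv.coe_fn_mk]
    rw [show ∀ A B C D : ℂ, A * B * (C * D) = A * C * (B * D) by intros; ring, ← Complex.exp_add]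
    congr 2
    push_cast; ring
  · dsimp only
    rw [← (Equiv.addRight (N:ℤ)).tsum_eq, ← tsum_mul_left]
    apply tsum_congr
    intro k
    simp only [Equiv.coe_addRight]
    rw [show n + ((N + M : ℕ) : ℤ) - (k + N) = (n - k) + M by push_cast; ring, hc', hd']
    rw [show ∀ A B C D E F : ℂ, A * B * C * (D * E * F) = A * D * (B * E) * (C * F) by intros; ring,
      ← Complex.exp_add, pow_add]
    congr 3
    push_cast; ring

lemma IsT_prod {τ : ℂ} (hτ : 0 < τ.im) {ι : Type*} (S : Finset ι) (a : ι → ℂ) :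
    IsT τ S.card (∑ i ∈ S, a i) (fun v => ∏ i ∈ S, theta1 (v + a i) τ) := by
  classical
  induction S using Finset.induction_on with
  | empty => simpa using IsT_one τ
  | insert i S hi ih =>
    rw [Finset.card_insert_of_notMem hi, Finset.sum_insert hi, add_comm S.card]
    simp_rw [Finset.prod_insert hi]
    exact IsT_mul (IsT_theta hτ _) ih

lemma IsT_basis {τ : ℂ} {N : ℕ} (hN : N ≠ 0) {m : ℤ} {f : ℂ → ℂ} (hf : IsT τ N (m / 2) f) :
    ∃ C : Fin N → ℂ, ∀ v, f v = ∑ a : Fin N, C a * gS N m a τ v := by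
  have hN' : (N : ℂ) ≠ 0 := by exact_mod_cast hN
  have : NeZero N := ⟨hN⟩
  obtain ⟨c, hc, hc'⟩ := hf
  have step : ∀ n : ℤ, c (n + N) = (-1 : ℂ) ^ ((N : ℤ) + m) * Complex.exp (2 * Real.pi * Complex.I * (τ * n)) * c n := by
    intro n
    rw [hc', mul_add, Complex.exp_add, zpow_add₀ (by norm_num), negone_zpow m, zpow_natCast, ← mul_assoc]
    congr 4
    ring
  have key : ∀ (a : Fin N) (k : ℤ), c (a + N * k) * Complex.exp (Real.pi * Complex.I * τ * ((a : ℂ) - N / 2) ^ 2 / N)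
      = c a *
      (((-1 : ℂ) ^ ((N : ℤ) + m)) ^ k *  Complex.exp (Real.pi * Complex.I * τ * ((a : ℂ) - N / 2 + k * N) ^ 2 / N)) := by
    intro a k
    have hst : ∀ k : ℤ, c (a + N * (k + 1)) = (-1 : ℂ) ^ ((N : ℤ) + m) * Complex.exp (2 * Real.pi * Complex.I * (τ * (a + N * k))) * c (a + N * k) := by
      intro k
      rw [show (a : ℤ) + N * (k + 1) = (a + N * k) + N by ring, step]
      push_cast; rfl
    have hex : ∀ k : ℤ, Complex.exp (Real.pi * Complex.I * τ * ((a : ℂ) - N / 2 + ((k+1:ℤ) :ℂ) * N) ^ 2 / N) =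
       Complex.exp (2 * Real.pi * Complex.I * (τ * (a + N * k))) * Complex.exp (Real.pi * Complex.I * τ * ((a : ℂ) - N / 2 + k * N) ^ 2 / N) := by
      intro k
      rw [← Complex.exp_add]
      congr 1
      push_cast
      field_simp
      ring
    have he : ((-1 : ℂ) ^ ((N : ℤ) + m)) ≠ 0 := zpow_ne_zero _ (by norm_num)
    induction k using Int.induction_on with
    | zero => simp
    | succ k ih =>
      rw [hst, hex, zpow_add₀ he, zpow_one]
      linear_combination ((-1 : ℂ) ^ ((N : ℤ) + m) * Complex.exp (2 * Real.pi * Complex.I * (τ * (a + N * (k:ℤ))))) * ih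
    | pred k ih =>
      have h1 := hst (-k - 1)
      have h2 := hex (-k - 1)
      have h3 : ((-1 : ℂ) ^ ((N : ℤ) + m)) ^ (-(k:ℤ)) = ((-1 : ℂ) ^ ((N : ℤ) + m)) ^ (-(k:ℤ) - 1) * ((-1 : ℂ) ^ ((N : ℤ) + m)) := by
        rw [← zpow_add_one₀ he]; congr 1; ring
      rw [sub_add_cancel] at h1 h2
      rw [h1, h2, h3] at ih
      apply mul_left_cancel₀ (mul_ne_zero he (Complex.exp_ne_zero (2 * Real.pi * Complex.I * (τ * (a + N * ((-(k:ℤ) - 1 : ℤ) : ℂ))))))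
      linear_combination ih
  refine ⟨fun a => c a * (Complex.exp (Real.pi * Complex.I * τ * ((a : ℂ) - N / 2) ^ 2 / N))⁻¹, fun v => ?_⟩
  have h1 := (Int.divModEquiv N).symm.hasSum_iff.mpr (hc v)
  have h2 := (Equiv.prodComm (Fin N) ℤ).hasSum_iff.mpr h1
  have h3 := h2.prod_fiberwise (fun a => (h2.summable.prod_factor a).hasSum)
  rw [← (hasSum_fintype _).unique h3]
  apply Finset.sum_congr rfl
  intro a _
  rw [gS, ← tsum_mul_left]
  apply tsum_congr
  intro k
  simp only [Function.comp, Equiv.prodComm_apply, Prod.swap, Int.divModEquiv_symm_apply]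
  rw [gT, Complex.exp_add]
  have e0 := Complex.exp_ne_zero (Real.pi * Complex.I * τ * ((a : ℂ) - N / 2) ^ 2 / N)
  have hc1 : c (k * N + a) = c (a + N * k) := by congr 1; ring
  rw [hc1]
  have hk' : c (a + N * k) = _ := (eq_div_iff e0).mpr (key a k)
  rw [hk']
  rw [show ((k * N + a : ℤ) : ℂ) - N / 2 = (a : ℂ) - N / 2 + k * N by push_cast; ring]
  field_simp


open MeasureTheory in
lemma gauss_term {t : ℝ} (ht : 0 < t) (k d : ℂ) :
    Integrable (fun w : ℝ => ((Real.exp (-w ^ 2 / (2 * t)) / Real.sqrt (2 * Real.pi * t) : ℝ) : ℂ) *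
      Complex.exp (k * w + d)) ∧
    ∫ w : ℝ, ((Real.exp (-w ^ 2 / (2 * t)) / Real.sqrt (2 * Real.pi * t) : ℝ) : ℂ) *
      Complex.exp (k * w + d) = Complex.exp (k ^ 2 * t / 2 + d) := by
  have ht' : (t : ℂ) ≠ 0 := by exact_mod_cast ht.ne'
  have hs : 0 < Real.sqrt (2 * Real.pi * t) := Real.sqrt_pos.mpr (by positivity)
  have hs' : ((Real.sqrt (2 * Real.pi * t) : ℝ) : ℂ) ≠ 0 := by exact_mod_cast hs.ne'
  have hb : (-(1 / (2 * t)) : ℂ).re < 0 := by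
    have : (-(1 / (2 * t)) : ℂ) = ((-(1 / (2 * t)) : ℝ) : ℂ) := by push_cast; rfl
    rw [this, Complex.ofReal_re]
    have : 0 < 1 / (2 * t) := by positivity
    linarith
  have hf : (fun w : ℝ => ((Real.exp (-w ^ 2 / (2 * t)) / Real.sqrt (2 * Real.pi * t) : ℝ) : ℂ) *
      Complex.exp (k * w + d)) = fun w : ℝ => ((Real.sqrt (2 * Real.pi * t) : ℝ) : ℂ)⁻¹ *
        Complex.exp (-(1 / (2 * t)) * w ^ 2 + k * w + d) := by
    funext w
    rw [add_assoc, Complex.exp_add (-(1 / (2 * t)) * (w:ℂ) ^ 2)]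
    push_cast
    rw [show (-(w:ℂ) ^ 2 / (2 * t)) = -(1 / (2 * t)) * (w:ℂ) ^ 2 by ring]
    ring
  rw [hf]
  refine ⟨(integrable_cexp_quadratic' hb k d).const_mul _, ?_⟩
  rw [integral_const_mul, integral_cexp_quadratic hb]
  have h1 : (Real.pi / - -(1 / (2 * t)) : ℂ) = ((2 * Real.pi * t : ℝ) : ℂ) := by
    push_cast; field_simp
  have h2 : (((2 * Real.pi * t : ℝ) : ℂ)) ^ (1 / 2 : ℂ) = ((Real.sqrt (2 * Real.pi * t) : ℝ) : ℂ) := by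
    rw [Real.sqrt_eq_rpow, Complex.ofReal_cpow (by positivity)]; simp
  rw [h1, h2, ← mul_assoc, inv_mul_cancel₀ hs', one_mul]
  congr 1
  field_simp
  ring

/-- the common form of `gT` at the relevant parameters -/
lemma gT_form (N : ℕ) (hN : N ≠ 0) (m : ℤ) (a : ℕ) {r : ℝ} (hr : 0 < r) (s : ℝ) (x w : ℝ) (n : ℤ)
    (p : ℝ) (hp : p = (a : ℝ) - N / 2 + n * N) :
    gT N m a (Complex.I * N * s / (2 * Real.pi * r ^ 2)) (((x : ℂ) + Complex.I * w) / (2 * Real.pi * r)) n =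
    ((-1 : ℂ) ^ ((N : ℤ) + m)) ^ n *
      Complex.exp (((-(p / r) : ℝ) : ℂ) * w + (((-(p ^ 2 * s / (2 * r ^ 2)) : ℝ) : ℂ) + ((p * x / r : ℝ) : ℂ) * Complex.I)) := by
  have hN' : (N : ℂ) ≠ 0 := by exact_mod_cast hN
  have hr' : (r : ℂ) ≠ 0 := by exact_mod_cast hr.ne'
  have hpi : (Real.pi : ℂ) ≠ 0 := by exact_mod_cast Real.pi_ne_zero
  have hp' : (a : ℂ) - N / 2 + n * N = (p : ℂ) := by rw [hp]; push_cast; ring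
  unfold gT
  rw [hp']
  congr 2
  push_cast
  field_simp
  ring_nf
  simp only [Complex.I_sq]
  ring

open MeasureTheory in
lemma gT_heat (N : ℕ) (hN : N ≠ 0) (m : ℤ) (a : ℕ) {r : ℝ} (hr : 0 < r) {t ts : ℝ} (ht : 0 < t)
    (x : ℝ) (n : ℤ) :
    Integrable (fun w : ℝ => ((Real.exp (-w ^ 2 / (2 * t)) / Real.sqrt (2 * Real.pi * t) : ℝ) : ℂ) *
      gT N m a (Complex.I * N * ts / (2 * Real.pi * r ^ 2)) (((x : ℂ) + Complex.I * w) / (2 * Real.pi * r)) n) ∧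
    (∫ w : ℝ, ((Real.exp (-w ^ 2 / (2 * t)) / Real.sqrt (2 * Real.pi * t) : ℝ) : ℂ) *
      gT N m a (Complex.I * N * ts / (2 * Real.pi * r ^ 2)) (((x : ℂ) + Complex.I * w) / (2 * Real.pi * r)) n) =
      gT N m a (Complex.I * N * (ts - t : ℝ) / (2 * Real.pi * r ^ 2)) ((x : ℂ) / (2 * Real.pi * r)) n ∧
    (∫ w : ℝ, ‖((Real.exp (-w ^ 2 / (2 * t)) / Real.sqrt (2 * Real.pi * t) : ℝ) : ℂ) *
      gT N m a (Complex.I * N * ts / (2 * Real.pi * r ^ 2)) (((x : ℂ) + Complex.I * w) / (2 * Real.pi * r)) n‖) =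
      ‖gT N m a (Complex.I * N * (ts - t : ℝ) / (2 * Real.pi * r ^ 2)) ((x : ℂ) / (2 * Real.pi * r)) n‖ := by
  have hr' : (r : ℂ) ≠ 0 := by exact_mod_cast hr.ne'
  obtain ⟨p, hp⟩ : ∃ p : ℝ, p = (a : ℝ) - N / 2 + n * N := ⟨_, rfl⟩
  have h0 := gT_form N hN m a hr (ts - t) x 0 n p hp
  rw [Complex.ofReal_zero, mul_zero, mul_zero, zero_add, add_zero] at h0
  simp only [gT_form N hN m a hr ts x _ n p hp, h0]
  have he : ‖((-1 : ℂ) ^ ((N : ℤ) + m)) ^ n‖ = 1 := by simp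
  set e := ((-1 : ℂ) ^ ((N : ℤ) + m)) ^ n
  obtain ⟨g1, g2⟩ := gauss_term ht ((-(p / r) : ℝ) : ℂ)
    (((-(p ^ 2 * ts / (2 * r ^ 2)) : ℝ) : ℂ) + ((p * x / r : ℝ) : ℂ) * Complex.I)
  obtain ⟨g3, g4⟩ := gauss_term ht ((-(p / r) : ℝ) : ℂ) (((-(p ^ 2 * ts / (2 * r ^ 2)) : ℝ) : ℂ))
  simp_rw [mul_left_comm _ e]
  refine ⟨g1.const_mul _, ?_, ?_⟩
  · rw [integral_const_mul, g2]
    congr 2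
    push_cast
    field_simp
    ring
  · simp_rw [norm_mul, he, one_mul]
    apply Complex.ofReal_injective
    rw [← integral_complex_ofReal]
    rw [Complex.norm_exp]
    have : ∀ w : ℝ, ((‖((Real.exp (-w ^ 2 / (2 * t)) / Real.sqrt (2 * Real.pi * t) : ℝ) : ℂ)‖ *
        ‖Complex.exp (((-(p / r) : ℝ) : ℂ) * w + (((-(p ^ 2 * ts / (2 * r ^ 2)) : ℝ) : ℂ) + ((p * x / r : ℝ) : ℂ) * Complex.I))‖ : ℝ) : ℂ)
        = ((Real.exp (-w ^ 2 / (2 * t)) / Real.sqrt (2 * Real.pi * t) : ℝ) : ℂ) *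
          Complex.exp (((-(p / r) : ℝ) : ℂ) * w + (((-(p ^ 2 * ts / (2 * r ^ 2)) : ℝ) : ℂ))) := by
      intro w
      rw [Complex.norm_exp, Complex.norm_real, Real.norm_of_nonneg (by positivity), Complex.ofReal_mul]
      congr 1
      rw [Complex.ofReal_exp]
      congr 1
      have : (((-(p / r) : ℝ) : ℂ) * w + (((-(p ^ 2 * ts / (2 * r ^ 2)) : ℝ) : ℂ) + ((p * x / r : ℝ) : ℂ) * Complex.I)).re
        = -(p / r) * w + (-(p ^ 2 * ts / (2 * r ^ 2))) := by
          rw [Complex.add_re, Complex.add_re, Complex.re_ofReal_mul, Complex.re_ofReal_mul,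
            Complex.I_re, Complex.ofReal_re, Complex.ofReal_re]
          ring
      rw [this]; push_cast; ring
    simp_rw [this]
    rw [g4, Complex.ofReal_exp]
    congr 1
    rw [Complex.add_re, Complex.re_ofReal_mul, Complex.I_re, Complex.ofReal_re]
    push_cast
    field_simp
    ring

lemma im_tau {N : ℕ} (hN : N ≠ 0) {r s : ℝ} (hr : 0 < r) (hs : 0 < s) :
    0 < (Complex.I * N * s / (2 * Real.pi * r ^ 2) : ℂ).im := by
  have : (Complex.I * N * s / (2 * Real.pi * r ^ 2) : ℂ) = ((N * s / (2 * Real.pi * r ^ 2) : ℝ) : ℂ) * Complex.I := by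
    push_cast; ring
  rw [this, Complex.im_ofReal_mul, Complex.I_im, mul_one]
  have : 0 < (N : ℝ) := by exact_mod_cast Nat.pos_of_ne_zero hN
  have := Real.pi_pos
  positivity

lemma gT_norm_summable (N : ℕ) (hN : N ≠ 0) (m : ℤ) (D : Fin N → ℂ) (τ v : ℂ) (hτ : 0 < τ.im) :
    Summable (fun q : Fin N × ℤ => ‖D q.1‖ * ‖gT N m q.1 τ v q.2‖) := by
  rw [summable_prod_of_nonneg (fun q => by positivity)]
  refine ⟨fun a => ?_, (hasSum_fintype _).summable⟩
  have h := (gT_summable N hN m a hτ v).norm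
  exact h.mul_left ‖D a‖

lemma gT_hasSum_prod (N : ℕ) (hN : N ≠ 0) (m : ℤ) (D : Fin N → ℂ) (τ v : ℂ) (hτ : 0 < τ.im) :
    HasSum (fun q : Fin N × ℤ => D q.1 * gT N m q.1 τ v q.2) (∑ a : Fin N, D a * gS N m a τ v) := by
  have hs : Summable (fun q : Fin N × ℤ => D q.1 * gT N m q.1 τ v q.2) := by
    apply Summable.of_norm
    simp_rw [norm_mul]
    exact gT_norm_summable N hN m D τ v hτ
  have h1 := hs.hasSum.prod_fiberwise (fun a => ((gT_summable N hN m a hτ v).hasSum.mul_left (D a)))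
  have h2 := (hasSum_fintype (fun a : Fin N => D a * gS N m a τ v))
  rw [h2.unique h1]
  exact hs.hasSum

open MeasureTheory in
lemma heat (N : ℕ) (hN : N ≠ 0) (m : ℤ) {r : ℝ} (hr : 0 < r) {t ts : ℝ} (ht : 0 < t) (hts : t < ts)
    (C : Fin N → ℂ) (x : ℝ) :
    (∫ w : ℝ, ((Real.exp (-w ^ 2 / (2 * t)) / Real.sqrt (2 * Real.pi * t) : ℝ) : ℂ) *
      ∑ a : Fin N, C a * gS N m a (Complex.I * N * ts / (2 * Real.pi * r ^ 2)) (((x : ℂ) + Complex.I * w) / (2 * Real.pi * r))) =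
     ∑ a : Fin N, C a * gS N m a (Complex.I * N * (ts - t : ℝ) / (2 * Real.pi * r ^ 2)) ((x : ℂ) / (2 * Real.pi * r)) := by
  let G : ℝ → ℂ := fun w => ((Real.exp (-w ^ 2 / (2 * t)) / Real.sqrt (2 * Real.pi * t) : ℝ) : ℂ)
  let F : Fin N × ℤ → ℝ → ℂ := fun q w => C q.1 * (G w *
      gT N m q.1 (Complex.I * N * ts / (2 * Real.pi * r ^ 2)) (((x : ℂ) + Complex.I * w) / (2 * Real.pi * r)) q.2)
  have τ1 := im_tau hN hr (ht.trans hts)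
  have τ2 := im_tau hN hr (sub_pos.mpr hts)
  have hI : ∀ q, Integrable (F q) := fun q => (gT_heat N hN m q.1 hr ht x q.2).1.const_mul _
  have hI2 : ∀ q : Fin N × ℤ, ∫ w, F q w = C q.1 * gT N m q.1 (Complex.I * N * (ts - t : ℝ) / (2 * Real.pi * r ^ 2)) ((x : ℂ) / (2 * Real.pi * r)) q.2 := by
    intro q
    rw [← (gT_heat N hN m q.1 hr ht x q.2).2.1, ← integral_const_mul]
  have hI3 : ∀ q : Fin N × ℤ, ∫ w, ‖F q w‖ = ‖C q.1‖ * ‖gT N m q.1 (Complex.I * N * (ts - t : ℝ) / (2 * Real.pi * r ^ 2)) ((x : ℂ) / (2 * Real.pi * r)) q.2‖ := by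
    intro q
    rw [← (gT_heat N hN m q.1 hr ht x q.2).2.2, ← integral_const_mul]
    simp only [F, norm_mul, G]
  have hS : Summable fun q => ∫ w, ‖F q w‖ := by
    simp_rw [hI3]
    exact gT_norm_summable N hN m C _ _ τ2
  have hmain := hasSum_integral_of_summable_integral_norm hI hS
  simp_rw [hI2] at hmain
  rw [← hmain.unique (gT_hasSum_prod N hN m C _ _ τ2)]
  congr 1
  funext w
  rw [← (gT_hasSum_prod N hN m C _ _ τ1).tsum_eq, ← tsum_mul_left]
  apply tsum_congr
  intro q
  simp only [F, G]
  ring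


lemma expand_aux {N : ℕ} (y : Fin N → ℂ) (L : Fin N → ℂ → ℂ) : ∀ (n : ℕ) (P : (Fin n → ℂ) → ℂ)
    (_ : ∀ w l v, P (Function.update w l v) = ∑ k, L k v * P (Function.update w l (y k))) (w : Fin n → ℂ),
    P w = ∑ κ : Fin n → Fin N, (∏ j, L (κ j) (w j)) * P (y ∘ κ) := by
  intro n
  induction n with
  | zero =>
    intro P _ w
    simp
    congr 1
    exact Subsingleton.elim _ _
  | succ n ih =>
    intro P hP w
    have h1 := hP w 0 (w 0)
    rw [Function.update_eq_self] at h1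
    rw [h1, ← (Fin.consEquiv (fun _ => Fin N)).sum_comp, Fintype.sum_prod_type]
    apply Finset.sum_congr rfl
    intro k _
    have h2 : ∀ z, Function.update w 0 z = Fin.cons z (Fin.tail w) := by
      intro z
      conv_lhs => rw [← Fin.cons_self_tail w]
      rw [Fin.update_cons_zero]
    rw [h2, ih (fun w' => P (Fin.cons (y k) w')), Finset.mul_sum]
    · apply Finset.sum_congr rfl
      intro κ _
      rw [Fin.prod_univ_succ, mul_assoc, ← mul_assoc, ← mul_assoc]
      congr 1
      congr 1
      funext i
      refine Fin.cases ?_ (fun i => ?_) i <;> simp [Fin.consEquiv]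
    · intro w' l v
      have := hP (Fin.cons (y k) w') l.succ v
      simp only [Fin.cons_update]
      exact this

lemma alt_det {N : ℕ} (y : Fin N → ℂ) (L : Fin N → ℂ → ℂ) (P : (Fin N → ℂ) → ℂ)
    (hP : ∀ w l v, P (Function.update w l v) = ∑ k, L k v * P (Function.update w l (y k)))
    (hσ : ∀ w (σ : Equiv.Perm (Fin N)), P (w ∘ σ) = ((σ.sign : ℤ) : ℂ) * P w)
    (h0 : ∀ w : Fin N → ℂ, ¬ Function.Injective w → P w = 0) (w : Fin N → ℂ) :
    P w = P y * Matrix.det (Matrix.of fun j k : Fin N => L k (w j)) := by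
  rw [expand_aux y L N P hP w, ← Matrix.det_transpose, Matrix.det_apply', Finset.mul_sum]
  symm
  apply Fintype.sum_of_injective (fun σ : Equiv.Perm (Fin N) => (σ : Fin N → Fin N)) DFunLike.coe_injective
  · intro κ hκ
    rw [h0, mul_zero]
    intro hinj
    apply hκ
    have : Function.Injective κ := Function.Injective.of_comp hinj
    exact ⟨Equiv.ofBijective κ (Finite.injective_iff_bijective.mp this), rfl⟩
  · intro σ
    rw [hσ]
    simp only [Matrix.transpose_apply, Matrix.of_apply]
    ring

lemma alt_main {N : ℕ} (g : Fin N → ℂ → ℂ) (P : (Fin N → ℂ) → ℂ)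
    (hP : ∀ w l, ∃ C : Fin N → ℂ, ∀ v, P (Function.update w l v) = ∑ a, C a * g a v)
    (hσ : ∀ w (σ : Equiv.Perm (Fin N)), P (w ∘ σ) = ((σ.sign : ℤ) : ℂ) * P w)
    (h0 : ∀ w : Fin N → ℂ, ¬ Function.Injective w → P w = 0) (y : Fin N → ℂ)
    (hy : Matrix.det (Matrix.of fun j a : Fin N => g a (y j)) ≠ 0) (w : Fin N → ℂ) :
    P w * Matrix.det (Matrix.of fun j a : Fin N => g a (y j)) =
      P y * Matrix.det (Matrix.of fun j a : Fin N => g a (w j)) := by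
  set G := (Matrix.of fun j a : Fin N => g a (y j)) with hG
  have hu : IsUnit G.det := isUnit_iff_ne_zero.mpr hy
  have h := alt_det y (fun k v => ∑ a, g a v * G⁻¹ a k) P ?_ hσ h0 w
  · have hm : (Matrix.of fun j k : Fin N => ∑ a, g a (w j) * G⁻¹ a k) =
        (Matrix.of fun j a : Fin N => g a (w j)) * G⁻¹ := by
      ext j k
      simp [Matrix.mul_apply]
    have hd : G⁻¹.det * G.det = 1 := by
      rw [← Matrix.det_mul, Matrix.nonsing_inv_mul _ hu, Matrix.det_one]
    rw [h, hm, Matrix.det_mul]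
    linear_combination P y * (Matrix.of fun j a : Fin N => g a (w j)).det * hd
  · intro w l v
    obtain ⟨C, hC⟩ := hP w l
    have h1 : (fun k => P (Function.update w l (y k))) = G.mulVec C := by
      funext k
      rw [hC]
      simp [Matrix.mulVec, dotProduct, hG, mul_comm]
    have h2 : C = G⁻¹.mulVec (fun k => P (Function.update w l (y k))) := by
      rw [h1, Matrix.mulVec_mulVec, Matrix.nonsing_inv_mul _ hu, Matrix.one_mulVec]
    rw [hC]
    conv_lhs => rw [h2]
    simp only [Matrix.mulVec, dotProduct, Finset.sum_mul]
    rw [Finset.sum_comm]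
    apply Finset.sum_congr rfl
    intro k _
    apply Finset.sum_congr rfl
    intro a _
    ring

/-- the alternating theta product -/
noncomputable def PP (N : ℕ) (m : ℤ) (τ : ℂ) (w : Fin N → ℂ) : ℂ :=
  theta1 (m / 2 + ∑ j, w j) τ * ∏ j : Fin N, ∏ k : Fin N, if j < k then theta1 (w k - w j) τ else 1

lemma prod_ite_Ioi {N : ℕ} (f : Fin N → Fin N → ℂ) :
    (∏ j : Fin N, ∏ k : Fin N, if j < k then f j k else 1) = ∏ j : Fin N, ∏ k ∈ Finset.Ioi j, f j k := by
  apply Finset.prod_congr rfl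
  intro j _
  rw [Finset.prod_ite, Finset.prod_const_one, mul_one]
  congr 1
  ext k; simp

lemma PP_perm (N : ℕ) (m : ℤ) (τ : ℂ) (w : Fin N → ℂ) (σ : Equiv.Perm (Fin N)) :
    PP N m τ (w ∘ σ) = ((σ.sign : ℤ) : ℂ) * PP N m τ w := by
  unfold PP
  have h1 : ∑ j, (w ∘ σ) j = ∑ j, w j := Equiv.sum_comp σ w
  rw [h1, prod_ite_Ioi, prod_ite_Ioi]
  have := σ.prod_Ioi_comp_eq_sign_mul_prod (f := fun j k => theta1 (w k - w j) τ)
    (fun i j => by rw [← theta1_neg]; congr 1; ring)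
  simp only [Function.comp]
  rw [this]
  ring

lemma PP_zero (N : ℕ) (m : ℤ) (τ : ℂ) (w : Fin N → ℂ) (hw : ¬ Function.Injective w) :
    PP N m τ w = 0 := by
  unfold PP
  simp only [Function.Injective, not_forall] at hw
  obtain ⟨a, b, hab, hne⟩ := hw
  apply mul_eq_zero_of_right
  wlog h : a < b generalizing a b
  · exact this b a hab.symm (Ne.symm hne) (lt_of_le_of_ne (not_lt.mp h) (Ne.symm hne))
  apply Finset.prod_eq_zero (Finset.mem_univ a)
  apply Finset.prod_eq_zero (Finset.mem_univ b)
  rw [if_pos h, hab, sub_self, theta1_zero]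

lemma prod_pairs_split {N : ℕ} (f : Fin N → Fin N → ℂ) (l : Fin N) :
    (∏ j : Fin N, ∏ k : Fin N, if j < k then f j k else 1) =
     (∏ j ∈ Finset.univ.erase l, if l < j then f l j else f j l) *
      ∏ j ∈ Finset.univ.erase l, ∏ k ∈ Finset.univ.erase l, if j < k then f j k else 1 := by
  rw [← Finset.mul_prod_erase _ _ (Finset.mem_univ l), ← Finset.mul_prod_erase _ _ (Finset.mem_univ l)]
  rw [if_neg (lt_irrefl l), one_mul]
  have : ∀ j ∈ Finset.univ.erase l, (∏ k : Fin N, if j < k then f j k else 1) =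
      (if j < l then f j l else 1) * ∏ k ∈ Finset.univ.erase l, if j < k then f j k else 1 := by
    intro j _
    rw [← Finset.mul_prod_erase _ _ (Finset.mem_univ l)]
  rw [Finset.prod_congr rfl this, Finset.prod_mul_distrib, ← mul_assoc, ← Finset.prod_mul_distrib]
  congr 1
  apply Finset.prod_congr rfl
  intro j hj
  have hj := Finset.ne_of_mem_erase hj
  rcases lt_or_gt_of_ne hj with h | h
  · simp [h, h.not_gt]
  · simp [h, h.not_gt]

/-- translation data for product of thetas -/
lemma theta_prod_basis {τ : ℂ} (hτ : 0 < τ.im) {N : ℕ} (hN : N ≠ 0) (m : ℤ) (a : Fin N → ℂ)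
    (ha : ∑ i, a i = m / 2) :
    ∃ C : Fin N → ℂ, ∀ v, ∏ i, theta1 (v + a i) τ = ∑ k : Fin N, C k * gS N m k τ v := by
  apply IsT_basis hN
  have := IsT_prod hτ Finset.univ a
  rw [Finset.card_univ, Fintype.card_fin, ha] at this
  exact this

lemma PP_basis {τ : ℂ} (hτ : 0 < τ.im) {N : ℕ} (hN : N ≠ 0) (m : ℤ) (w : Fin N → ℂ) (l : Fin N) :
    ∃ C : Fin N → ℂ, ∀ v, PP N m τ (Function.update w l v) = ∑ k : Fin N, C k * gS N m k τ v := by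
  obtain ⟨C, hC⟩ := theta_prod_basis hτ hN m
    (Function.update (fun j => - w j) l (m / 2 + ∑ j ∈ Finset.univ.erase l, w j)) (by
      rw [← Finset.add_sum_erase _ _ (Finset.mem_univ l), Function.update_self]
      have : ∑ x ∈ Finset.univ.erase l, Function.update (fun j => - w j) l (m / 2 + ∑ j ∈ Finset.univ.erase l, w j) x = ∑ x ∈ Finset.univ.erase l, - w x := by
        apply Finset.sum_congr rfl
        intro x hx
        rw [Function.update_of_ne (Finset.ne_of_mem_erase hx)]
      rw [this, Finset.sum_neg_distrib]; ring)
  let K : ℂ := (∏ j ∈ Finset.univ.erase l, if l < j then (-1:ℂ) else 1) *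
    ∏ j ∈ Finset.univ.erase l, ∏ k ∈ Finset.univ.erase l, if j < k then theta1 (w k - w j) τ else 1
  refine ⟨fun k => K * C k, fun v => ?_⟩
  simp_rw [mul_assoc, ← Finset.mul_sum, ← hC]
  unfold PP
  rw [prod_pairs_split _ l, ← Finset.mul_prod_erase _ _ (Finset.mem_univ l),
    ← Finset.add_sum_erase _ _ (Finset.mem_univ l), Function.update_self, Function.update_self]
  have hu : ∀ x ∈ Finset.univ.erase l, Function.update w l v x = w x := fun x hx => by
    rw [Function.update_of_ne (Finset.ne_of_mem_erase hx)]
  rw [Finset.sum_congr rfl hu]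
  have h1 : (∏ j ∈ Finset.univ.erase l, ∏ k ∈ Finset.univ.erase l,
      if j < k then theta1 (Function.update w l v k - Function.update w l v j) τ else 1) =
      ∏ j ∈ Finset.univ.erase l, ∏ k ∈ Finset.univ.erase l, if j < k then theta1 (w k - w j) τ else 1 :=
    Finset.prod_congr rfl fun j hj => Finset.prod_congr rfl fun k hk => by rw [hu j hj, hu k hk]
  have h2 : (∏ j ∈ Finset.univ.erase l, if l < j then theta1 (Function.update w l v j - v) τ
       else theta1 (v - Function.update w l v j) τ) =
     (∏ j ∈ Finset.univ.erase l, if l < j then (-1:ℂ) else 1) * ∏ j ∈ Finset.univ.erase l,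
       theta1 (v + Function.update (fun j => - w j) l (m / 2 + ∑ j ∈ Finset.univ.erase l, w j) j) τ := by
    rw [← Finset.prod_mul_distrib]
    apply Finset.prod_congr rfl
    intro j hj
    rw [hu j hj, Function.update_of_ne (Finset.ne_of_mem_erase hj)]
    split_ifs
    · rw [neg_one_mul, ← theta1_neg]; congr 1; ring
    · rw [one_mul]; rfl
  rw [h1, h2, show (m / 2 + (v + ∑ j ∈ Finset.univ.erase l, w j) : ℂ) = v + (m / 2 + ∑ j ∈ Finset.univ.erase l, w j) by ring]
  simp only [K]
  ring

lemma PP_det {τ : ℂ} (hτ : 0 < τ.im) {N : ℕ} (hN : N ≠ 0) (m : ℤ) (y : Fin N → ℂ)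
    (hy : Matrix.det (Matrix.of fun j a : Fin N => gS N m a τ (y j)) ≠ 0) (w : Fin N → ℂ) :
    PP N m τ w * Matrix.det (Matrix.of fun j a : Fin N => gS N m a τ (y j)) =
      PP N m τ y * Matrix.det (Matrix.of fun j a : Fin N => gS N m a τ (w j)) :=
  alt_main (fun a v => gS N m a τ v) (PP N m τ) (PP_basis hτ hN m) (PP_perm N m τ) (PP_zero N m τ) y hy w


/-- infinite product -/
noncomputable def ep (x q : ℂ) : ℂ := ∏' i : ℕ, (1 + x * q ^ i)

lemma ep_tendsto {q : ℂ} (hq : ‖q‖ < 1) (x : ℂ) :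
    Filter.Tendsto (fun n => ∏ i ∈ Finset.range n, (1 + x * q ^ i)) Filter.atTop
      (nhds (ep x q)) := tprod_tendsto hq x

lemma ep_succ {q : ℂ} (hq : ‖q‖ < 1) (x : ℂ) : ep x q = (1 + x) * ep (x * q) q := by
  have h1 := (ep_tendsto hq x).comp (Filter.tendsto_add_atTop_nat 1)
  have h2 := (ep_tendsto hq (x * q)).const_mul (1 + x)
  refine tendsto_nhds_unique h1 (h2.congr ?_)
  intro n
  simp only [Function.comp]
  rw [Finset.prod_range_succ']
  rw [pow_zero, mul_one, mul_comm]
  congr 1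
  apply Finset.prod_congr rfl
  intro i _
  ring

lemma prod_range_regroup (f : ℕ → ℂ) (N n : ℕ) :
    ∏ i ∈ Finset.range (N * n), f i = ∏ a ∈ Finset.range N, ∏ k ∈ Finset.range n, f (a + N * k) := by
  induction n with
  | zero => simp
  | succ n ih =>
    rw [mul_add, mul_one, Finset.prod_range_add, ih, ← Finset.prod_mul_distrib]
    apply Finset.prod_congr rfl
    intro a _
    rw [Finset.prod_range_succ, add_comm a]

lemma pow_norm_lt {q : ℂ} (hq : ‖q‖ < 1) {N : ℕ} (hN : N ≠ 0) : ‖q ^ N‖ < 1 := by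
  rw [norm_pow]; exact pow_lt_one₀ (norm_nonneg _) hq hN

lemma ep_regroup {q : ℂ} (hq : ‖q‖ < 1) (x : ℂ) {N : ℕ} (hN : N ≠ 0) :
    ∏ a ∈ Finset.range N, ep (x * q ^ a) (q ^ N) = ep x q := by
  have h1 : Filter.Tendsto (fun n => ∏ i ∈ Finset.range (N * n), (1 + x * q ^ i)) Filter.atTop
      (nhds (ep x q)) := (ep_tendsto hq x).comp
        (Filter.tendsto_id.const_mul_atTop' (Nat.pos_of_ne_zero hN))
  have h2 := tendsto_finsetProd (Finset.range N) (fun a _ => ep_tendsto (pow_norm_lt hq hN) (x * q ^ a))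
  refine tendsto_nhds_unique (h2.congr ?_) h1
  intro n
  rw [prod_range_regroup]
  apply Finset.prod_congr rfl
  intro a _
  apply Finset.prod_congr rfl
  intro k _
  rw [← pow_mul, pow_add]; ring

lemma root_prod {N : ℕ} (hN : N ≠ 0) {ζ : ℂ} (hζ : IsPrimitiveRoot ζ N) (x : ℂ) :
    ∏ l ∈ Finset.range N, (1 - ζ ^ l * x) = 1 - x ^ N := by
  have h := hζ.pow_sub_pow_eq_prod_sub_mul 1 x (Nat.pos_of_ne_zero hN)
  rw [one_pow] at h
  rw [h]
  haveI : NeZero N := ⟨hN⟩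
  refine Finset.prod_bij (fun l _ => ζ ^ l) ?_ ?_ ?_ ?_
  · intro l _
    rw [Polynomial.mem_nthRootsFinset (Nat.pos_of_ne_zero hN)]
    rw [← pow_mul, mul_comm, pow_mul, hζ.pow_eq_one, one_pow]
  · intro a ha b hb hab
    exact hζ.pow_inj (Finset.mem_range.mp ha) (Finset.mem_range.mp hb) hab
  · intro b hb
    rw [Polynomial.mem_nthRootsFinset (Nat.pos_of_ne_zero hN)] at hb
    obtain ⟨i, hi, h⟩ := hζ.eq_pow_of_pow_eq_one hb
    exact ⟨i, Finset.mem_range.mpr hi, h⟩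
  · intro a _; rfl

lemma ep_roots {q : ℂ} (hq : ‖q‖ < 1) {N : ℕ} (hN : N ≠ 0) {ζ : ℂ} (hζ : IsPrimitiveRoot ζ N) :
    ∏ l ∈ Finset.range N, ep (-ζ ^ l * q) q = qinf (q ^ N) := by
  have h2 := tendsto_finsetProd (Finset.range N) (fun l _ => ep_tendsto hq (-ζ ^ l * q))
  have h1 := ep_tendsto (pow_norm_lt hq hN) (-q ^ N)
  rw [qinf_eq]
  refine tendsto_nhds_unique (h2.congr ?_) h1
  intro n
  rw [Finset.prod_comm]
  apply Finset.prod_congr rfl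
  intro i _
  have := root_prod hN hζ (q * q ^ i)
  rw [mul_pow] at this
  rw [show 1 + -q ^ N * (q ^ N) ^ i = 1 - q ^ N * (q ^ i) ^ N by rw [← pow_mul, ← pow_mul, mul_comm N i]; ring,
    ← this]
  apply Finset.prod_congr rfl
  intro l _
  ring

/-- for any integer shift -/
lemma ep_roots_shift {q : ℂ} (hq : ‖q‖ < 1) {N : ℕ} (hN : N ≠ 0) {ζ : ℂ} (hζ : IsPrimitiveRoot ζ N)
    (j : Fin N) :
    ∏ k : Fin N, ep (-ζ ^ ((k : ℤ) - (j : ℤ)) * q) q = qinf (q ^ N) := by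
  rw [← ep_roots hq hN hζ, ← Fin.prod_univ_eq_prod_range (fun l => ep (-ζ ^ l * q) q)]
  haveI : NeZero N := ⟨hN⟩
  rw [← (Equiv.subRight j).prod_comp (fun k : Fin N => ep (-ζ ^ (k:ℕ) * q) q)]
  apply Finset.prod_congr rfl
  intro k _
  congr 3
  simp only [Equiv.subRight_apply]
  rw [← zpow_natCast]
  have h0 : ζ ≠ 0 := hζ.ne_zero hN
  rw [Fin.val_sub]
  have hj := j.2
  have e : (((N - (j:ℕ) + (k:ℕ)) % N : ℕ) : ℤ) = (k:ℤ) - j + N * (1 - ((N - (j:ℕ) + (k:ℕ)) / N : ℕ)) := by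
    have := Nat.mod_add_div (N - (j:ℕ) + (k:ℕ)) N
    zify [hj.le] at this ⊢
    linarith
  rw [e, zpow_add₀ h0, zpow_mul, zpow_natCast, hζ.pow_eq_one, one_zpow, mul_one]


/-- constant factor -/
noncomputable def cst (v : ℂ) : ℂ :=
  Complex.I * Complex.exp (-(Real.pi * Complex.I * v)) * (1 - Complex.exp (2 * Real.pi * Complex.I * v))

lemma theta1_split {τ : ℂ} (hτ : 0 < τ.im) (v x q : ℂ)
    (hx : x = Complex.exp (2 * Real.pi * Complex.I * v))
    (hq : q = Complex.exp (2 * Real.pi * Complex.I * τ)) :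
    theta1 v τ = cst v * (Complex.exp (2 * Real.pi * Complex.I * τ / 24) ^ 3 * qinf q *
      (ep (-x * q) q * ep (-x⁻¹ * q) q)) := by
  have hq1 : ‖q‖ < 1 := by rw [hq]; exact norm_q_lt hτ
  rw [theta1_prod hτ v x q hx hq]
  change _ * (_ * ep (-x) q * ep _ q) = _
  rw [ep_succ hq1 (-x), inv_neg, sub_eq_add_neg, Complex.exp_add, cst, ← hx, ← Complex.exp_nat_mul]
  rw [show ((3:ℕ):ℂ) * (2 * Real.pi * Complex.I * τ / 24) = Real.pi * Complex.I * τ / 4 by push_cast; ring]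
  ring

lemma prod_pairs_const (N : ℕ) (K : ℂ) :
    (∏ j : Fin N, ∏ k : Fin N, if j < k then K else 1) = K ^ (N * (N - 1) / 2) := by
  rw [prod_ite_Ioi (fun _ _ => K)]
  simp only [Finset.prod_const, Fin.card_Ioi]
  rw [Finset.prod_pow_eq_pow_sum]
  congr 1
  rw [Fin.sum_univ_eq_sum_range (fun j => N - 1 - j), Finset.sum_range_reflect (fun j => j), Finset.sum_range_id]

lemma prod_pairs_mul {N : ℕ} (f g : Fin N → Fin N → ℂ) :
    (∏ j : Fin N, ∏ k : Fin N, if j < k then f j k * g j k else 1) =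
    (∏ j : Fin N, ∏ k : Fin N, if j < k then f j k else 1) *
    (∏ j : Fin N, ∏ k : Fin N, if j < k then g j k else 1) := by
  simp only [← Finset.prod_mul_distrib]
  refine Finset.prod_congr rfl fun j _ => Finset.prod_congr rfl fun k _ => ?_
  split_ifs <;> simp

lemma prod_pairs_sym {N : ℕ} (f : Fin N → Fin N → ℂ) :
    (∏ j : Fin N, ∏ k : Fin N, if j < k then f j k * f k j else 1) * ∏ j, f j j =
    ∏ j : Fin N, ∏ k : Fin N, f j k := by
  rw [prod_pairs_mul, Finset.prod_comm (f := fun j k => if j < k then f k j else 1)]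
  have : ∏ j, f j j = ∏ j : Fin N, ∏ k : Fin N, if j = k then f j k else 1 := by simp
  rw [this]
  simp only [← Finset.prod_mul_distrib]
  refine Finset.prod_congr rfl fun j _ => Finset.prod_congr rfl fun k _ => ?_
  rcases lt_trichotomy j k with h | h | h
  · simp [h, h.ne, h.not_gt]
  · simp [h]
  · simp [h, h.ne', h.not_gt]

lemma prod_pairs_congr {N : ℕ} {f g : Fin N → Fin N → ℂ} (h : ∀ j k, j < k → f j k = g j k) :
    (∏ j : Fin N, ∏ k : Fin N, if j < k then f j k else 1) =
    (∏ j : Fin N, ∏ k : Fin N, if j < k then g j k else 1) := by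
  refine Finset.prod_congr rfl fun j _ => Finset.prod_congr rfl fun k _ => ?_
  split_ifs with hh
  · exact h j k hh
  · rfl

lemma pair_theta {N : ℕ} (hN : N ≠ 0) : ∃ C : ℂ, C ≠ 0 ∧ ∀ τ : ℂ, 0 < τ.im →
    ∀ q : ℂ, q = Complex.exp (2 * Real.pi * Complex.I * τ) →
    (∏ j : Fin N, ∏ k : Fin N, if j < k then theta1 (((k:ℕ):ℂ) / N - ((j:ℕ):ℂ) / N) τ else 1) * qinf q ^ N =
    C * (Complex.exp (2 * Real.pi * Complex.I * τ / 24) ^ 3 * qinf q) ^ (N * (N - 1) / 2) * qinf (q ^ N) ^ N := by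
  refine ⟨∏ j : Fin N, ∏ k : Fin N, if j < k then cst (((k:ℕ):ℂ) / N - ((j:ℕ):ℂ) / N) else 1, ?_, ?_⟩
  · refine Finset.prod_ne_zero_iff.mpr fun j _ => Finset.prod_ne_zero_iff.mpr fun k _ => ?_
    split_ifs with h
    · unfold cst
      refine mul_ne_zero (mul_ne_zero Complex.I_ne_zero (Complex.exp_ne_zero _)) ?_
      intro h0
      have h1 := (sub_eq_zero.mp h0).symm
      rw [Complex.exp_eq_one_iff] at h1
      obtain ⟨n, hn⟩ := h1
      have hN' : (N : ℂ) ≠ 0 := by exact_mod_cast hN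
      have h3 : ((k:ℕ):ℂ) / N - ((j:ℕ):ℂ) / N = n := by
        apply mul_left_cancel₀ Complex.two_pi_I_ne_zero; rw [hn]; ring
      field_simp at h3
      have h4 : ((k:ℕ):ℤ) - (j:ℕ) = N * n := by exact_mod_cast h3
      have hk := k.2
      have h5 : (j:ℕ) < (k:ℕ) := h
      have h6 : (0:ℤ) < N * n := by rw [← h4]; omega
      have h7 : (N:ℤ) * n < N * 1 := by rw [← h4]; omega
      have h8 : n < 1 := lt_of_mul_lt_mul_left h7 (by omega)
      have h9 : 0 < n := by
        by_contra hc
        have : (N:ℤ) * n ≤ 0 := mul_nonpos_of_nonneg_of_nonpos (by omega) (by omega)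
        omega
      omega
    · exact one_ne_zero
  · intro τ hτ q hq
    have hq1 : ‖q‖ < 1 := by rw [hq]; exact norm_q_lt hτ
    have hζ := Complex.isPrimitiveRoot_exp N hN
    set ζ := Complex.exp (2 * Real.pi * Complex.I / N) with hζd
    have key := prod_pairs_sym (fun j k : Fin N => ep (-ζ ^ ((k : ℤ) - (j : ℤ)) * q) q)
    simp only [sub_self, zpow_zero, ep_roots_shift hq1 hN hζ, Finset.prod_const, Finset.card_univ,
      Fintype.card_fin] at key
    have h1 : ep (-1 * q) q = qinf q := by rw [qinf_eq, neg_one_mul]; rfl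
    rw [h1] at key
    rw [← key, ← prod_pairs_const]
    rw [prod_pairs_congr (fun j k _ => theta1_split hτ (((k:ℕ):ℂ) / N - ((j:ℕ):ℂ) / N) (ζ ^ ((k : ℤ) - (j : ℤ))) q
      (by rw [hζd, ← Complex.exp_int_mul]; congr 1; push_cast; ring) hq)]
    rw [prod_pairs_mul, prod_pairs_mul]
    have h2 : ∀ j k : Fin N, (ζ ^ ((k : ℤ) - (j : ℤ)))⁻¹ = ζ ^ ((j : ℤ) - (k : ℤ)) := by
      intro j k; rw [← zpow_neg]; congr 1; ring
    simp only [h2]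
    ring


lemma gS_shift (N : ℕ) (hN : N ≠ 0) (m : ℤ) (a : ℕ) (τ c : ℂ) (j : ℕ) :
    gS N m a τ ((j : ℂ) / N + c) =
      gS N m a τ c * (Complex.exp (-(Real.pi * Complex.I * j)) *
        (Complex.exp (2 * Real.pi * Complex.I / N) ^ j) ^ a) := by
  have hN' : (N : ℂ) ≠ 0 := by exact_mod_cast hN
  unfold gS
  rw [← tsum_mul_right]
  apply tsum_congr
  intro n
  unfold gT
  rw [mul_assoc (((-1 : ℂ) ^ ((N : ℤ) + m)) ^ n), ← pow_mul, ← Complex.exp_nat_mul, ← Complex.exp_add,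
    ← Complex.exp_add]
  congr 1
  rw [Complex.exp_eq_exp_iff_exists_int]
  refine ⟨n * j, ?_⟩
  push_cast
  field_simp
  ring

lemma sum_sq (N : ℕ) : ∑ a ∈ Finset.range N, ((a : ℂ)) = N * (N - 1) / 2 ∧
    ∑ a ∈ Finset.range N, ((a : ℂ)) ^ 2 = N * (N - 1) * (2 * N - 1) / 6 := by
  induction N with
  | zero => simp
  | succ n ih =>
    rw [Finset.sum_range_succ, Finset.sum_range_succ, ih.1, ih.2]
    push_cast
    constructor <;> ring

lemma sum_b (N : ℕ) (hN : N ≠ 0) (τ : ℂ) :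
    ∏ a : Fin N, Complex.exp (Real.pi * Complex.I * τ * (((a : ℕ) : ℂ) - N / 2) ^ 2 / N) =
      Complex.exp (2 * Real.pi * Complex.I * τ / 24) ^ (N ^ 2 + 2) := by
  have hN' : (N : ℂ) ≠ 0 := by exact_mod_cast hN
  rw [← Complex.exp_sum, ← Complex.exp_nat_mul]
  congr 1
  rw [Fin.sum_univ_eq_sum_range (fun a => Real.pi * Complex.I * τ * ((a : ℂ) - N / 2) ^ 2 / N)]
  have h : ∀ a : ℕ, Real.pi * Complex.I * τ * ((a : ℂ) - N / 2) ^ 2 / N =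
     (Real.pi * Complex.I * τ / N) * (a : ℂ) ^ 2 + (-(Real.pi * Complex.I * τ)) * (a : ℂ) +
     (Real.pi * Complex.I * τ * N / 4) := by
    intro a; field_simp; ring
  simp only [h]
  rw [Finset.sum_add_distrib, Finset.sum_add_distrib, ← Finset.mul_sum, ← Finset.mul_sum, (sum_sq N).1,
    (sum_sq N).2]
  simp only [Finset.sum_const, Finset.card_range, nsmul_eq_mul]
  push_cast
  field_simp
  ring

lemma prod_gS (N : ℕ) (hN : N ≠ 0) (m : ℤ) : ∃ C : ℂ, C ≠ 0 ∧ ∀ τ : ℂ, 0 < τ.im →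
    ∀ q : ℂ, q = Complex.exp (2 * Real.pi * Complex.I * τ) →
    ∏ a : Fin N, gS N m a τ (((N : ℂ) + m) / (2 * N)) =
    C * Complex.exp (2 * Real.pi * Complex.I * τ / 24) ^ (N ^ 2 + 2) * qinf (q ^ N) ^ N *
      (ep q q * ep q q) := by
  have hN' : (N : ℂ) ≠ 0 := by exact_mod_cast hN
  refine ⟨2 * ∏ a : Fin N, Complex.exp (2 * Real.pi * Complex.I * (((a : ℕ) : ℂ) - N / 2) * (((N : ℂ) + m) / (2 * N))), ?_, ?_⟩
  · refine mul_ne_zero two_ne_zero (Finset.prod_ne_zero_iff.mpr fun j _ => Complex.exp_ne_zero _)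
  intro τ hτ q hq
  have hq1 : ‖q‖ < 1 := by rw [hq]; exact norm_q_lt hτ
  have hq0 : q ≠ 0 := by rw [hq]; exact Complex.exp_ne_zero _
  have hX : ∀ a : ℕ, q ^ a = (-1 : ℂ) ^ ((N : ℤ) + m) * Complex.exp (2 * Real.pi * Complex.I * (a * τ + N * (((N : ℂ) + m) / (2 * N)))) := by
    intro a
    rw [hq, negone_zpow, ← Complex.exp_add, ← Complex.exp_nat_mul, Complex.exp_eq_exp_iff_exists_int]
    refine ⟨-(N + m), ?_⟩
    push_cast
    field_simp
    ring
  have hQ : q ^ N = Complex.exp (2 * Real.pi * Complex.I * (N * τ)) := by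
    rw [hq, ← Complex.exp_nat_mul]; congr 1; ring
  rw [Finset.prod_congr rfl (fun (a : Fin N) _ => gS_jtp N hN m a hτ _ (q ^ (a:ℕ)) (q ^ N) (hX a) hQ)]
  simp only [Complex.exp_add, Finset.prod_mul_distrib]
  rw [sum_b N hN]
  have e1 : ∏ a : Fin N, (∏' i : ℕ, (1 + q ^ (a:ℕ) * (q ^ N) ^ i)) = ep 1 q := by
    rw [← ep_regroup hq1 1 hN, Fin.prod_univ_eq_prod_range (fun a => ∏' i : ℕ, (1 + q ^ a * (q ^ N) ^ i))]
    simp only [one_mul]; rfl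
  have e2 : ∏ a : Fin N, (∏' i : ℕ, (1 + (q ^ (a:ℕ))⁻¹ * q ^ N * (q ^ N) ^ i)) = ep q q := by
    rw [← ep_regroup hq1 q hN, Fin.prod_univ_eq_prod_range (fun a => ∏' i : ℕ, (1 + (q ^ a)⁻¹ * q ^ N * (q ^ N) ^ i)),
      ← Finset.prod_range_reflect]
    apply Finset.prod_congr rfl
    intro a ha
    have ha := Finset.mem_range.mp ha
    unfold ep
    congr 1
    funext i
    congr 2
    rw [inv_mul_eq_div, div_eq_iff (pow_ne_zero _ hq0), mul_assoc, ← pow_add, ← pow_succ']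
    congr 1; omega
  rw [e1, e2, ep_succ hq1 1]
  simp only [Finset.prod_const, Finset.card_univ, Fintype.card_fin, one_mul]
  ring

lemma det_gS (N : ℕ) (hN : N ≠ 0) (m : ℤ) (y : Fin N → ℂ) (hy : y = fun j : Fin N => ((j : ℕ) : ℂ) / N + ((N : ℂ) + m) / (2 * N)) :
    ∃ C : ℂ, C ≠ 0 ∧ ∀ τ : ℂ, 0 < τ.im →
    ∀ q : ℂ, q = Complex.exp (2 * Real.pi * Complex.I * τ) →
    Matrix.det (Matrix.of fun j a : Fin N => gS N m a τ (y j)) =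
    C * Complex.exp (2 * Real.pi * Complex.I * τ / 24) ^ (N ^ 2 + 2) * qinf (q ^ N) ^ N *
      (ep q q * ep q q) := by
  obtain ⟨C, hC, h⟩ := prod_gS N hN m
  set ζ := Complex.exp (2 * Real.pi * Complex.I / N) with hζd
  have hζ : IsPrimitiveRoot ζ N := Complex.isPrimitiveRoot_exp N hN
  refine ⟨C * ((∏ j : Fin N, Complex.exp (-(Real.pi * Complex.I * (j:ℕ)))) *
    (Matrix.vandermonde (fun j : Fin N => ζ ^ (j:ℕ))).det), ?_, ?_⟩
  · refine mul_ne_zero hC (mul_ne_zero (Finset.prod_ne_zero_iff.mpr fun j _ => Complex.exp_ne_zero _) ?_)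
    rw [Matrix.det_vandermonde_ne_zero_iff]
    intro a b hab
    exact Fin.ext (hζ.pow_inj a.2 b.2 hab)
  intro τ hτ q hq
  have e : (Matrix.of fun j a : Fin N => gS N m a τ (y j)) =
     Matrix.of fun j a : Fin N => gS N m a τ (((N : ℂ) + m) / (2 * N)) *
       (Matrix.of fun j a : Fin N => Complex.exp (-(Real.pi * Complex.I * (j:ℕ))) *
         Matrix.vandermonde (fun j : Fin N => ζ ^ (j:ℕ)) j a) j a := by
    ext j a
    simp only [Matrix.of_apply, hy, Matrix.vandermonde_apply]
    rw [gS_shift N hN]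
  rw [e, Matrix.det_mul_row, Matrix.det_mul_column, h τ hτ q hq]
  ring

lemma PP_y (N : ℕ) (hN : N ≠ 0) (m : ℤ) (y : Fin N → ℂ) (hy : y = fun j : Fin N => ((j : ℕ) : ℂ) / N + ((N : ℂ) + m) / (2 * N)) :
    ∃ C : ℂ, C ≠ 0 ∧ ∀ τ : ℂ, 0 < τ.im →
    ∀ q : ℂ, q = Complex.exp (2 * Real.pi * Complex.I * τ) →
    PP N m τ y * qinf q ^ N =
    C * (Complex.exp (2 * Real.pi * Complex.I * τ / 24) ^ 3 * qinf q) ^ (1 + N * (N - 1) / 2) *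
      qinf (q ^ N) ^ N * (ep q q * ep q q) := by
  have hN' : (N : ℂ) ≠ 0 := by exact_mod_cast hN
  obtain ⟨C, hC, h⟩ := pair_theta hN
  have hs : (m : ℂ) / 2 + ∑ j, y j = m + N - 1 / 2 := by
    rw [hy, Finset.sum_add_distrib, ← Finset.sum_div, Fin.sum_univ_eq_sum_range (fun a => (a : ℂ)), (sum_sq N).1]
    simp only [Finset.sum_const, Finset.card_univ, Fintype.card_fin, nsmul_eq_mul]
    field_simp
    ring
  have hx : (-1 : ℂ) = Complex.exp (2 * Real.pi * Complex.I * (m + N - 1 / 2)) := by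
    rw [← Complex.exp_pi_mul_I, Complex.exp_eq_exp_iff_exists_int]
    refine ⟨-(m + N) + 1, ?_⟩
    push_cast
    ring
  refine ⟨cst (m + N - 1 / 2) * C, mul_ne_zero ?_ hC, ?_⟩
  · unfold cst
    rw [← hx]
    refine mul_ne_zero (mul_ne_zero Complex.I_ne_zero (Complex.exp_ne_zero _)) (by norm_num)
  intro τ hτ q hq
  unfold PP
  rw [hs, theta1_split hτ _ (-1) q hx hq, mul_assoc]
  have e : ∀ j k : Fin N, y k - y j = (((k:ℕ):ℂ) / N - ((j:ℕ):ℂ) / N) := by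
    intro j k; rw [hy]; ring
  simp only [e]
  rw [h τ hτ q hq]
  norm_num
  ring

lemma PP_eq (N : ℕ) (hN : N ≠ 0) (m : ℤ) :
    ∃ C : ℂ, C ≠ 0 ∧ ∀ τ : ℂ, 0 < τ.im → ∀ w : Fin N → ℂ,
    PP N m τ w = C * (Complex.exp (2 * Real.pi * Complex.I * τ / 24) *
      qinf (Complex.exp (2 * Real.pi * Complex.I * τ))) ^ ((N - 1) * (N - 2) / 2) *
      Matrix.det (Matrix.of fun j a : Fin N => gS N m a τ (w j)) := by
  obtain ⟨C, hC, h⟩ := PP_y N hN m _ rfl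
  obtain ⟨D, hD, h'⟩ := det_gS N hN m _ rfl
  refine ⟨C / D, div_ne_zero hC hD, ?_⟩
  intro τ hτ w
  have h1 := h τ hτ _ rfl
  have h2 := h' τ hτ _ rfl
  have hq1 := norm_q_lt hτ
  set q := Complex.exp (2 * Real.pi * Complex.I * τ)
  set E := Complex.exp (2 * Real.pi * Complex.I * τ / 24) with hE
  have hE0 : E ≠ 0 := Complex.exp_ne_zero _
  have hq0 : q ≠ 0 := Complex.exp_ne_zero _
  set y : Fin N → ℂ := fun j : Fin N => ((j : ℕ) : ℂ) / N + ((N : ℂ) + m) / (2 * N)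
  have hA := qinf_ne hq1
  have hB := qinf_ne (pow_norm_lt hq1 hN)
  have hP : ep q q ≠ 0 := by
    apply tprod_ne hq1
    intro i h0
    have h1 : q ^ (i + 1) = -1 := by rw [pow_succ']; linear_combination h0
    have h2 : ‖q‖ ^ (i + 1) = 1 := by rw [← norm_pow, h1]; simp
    have h3 : ‖q‖ ^ (i + 1) < 1 := pow_lt_one₀ (norm_nonneg _) hq1 (by omega)
    linarith
  have hdet : Matrix.det (Matrix.of fun j a : Fin N => gS N m a τ (y j)) ≠ 0 := by
    rw [h2]
    exact mul_ne_zero (mul_ne_zero (mul_ne_zero hD (pow_ne_zero _ hE0)) (pow_ne_zero _ hB)) (mul_ne_zero hP hP)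
  have h3 := PP_det hτ hN m y hdet w
  obtain ⟨d, hd1, hd2, hd3⟩ : ∃ d, (N - 1) * (N - 2) / 2 = d ∧ 1 + N * (N - 1) / 2 = N + d ∧
      3 * (1 + N * (N - 1) / 2) = d + (N ^ 2 + 2) := by
    refine ⟨_, rfl, ?_⟩
    obtain ⟨n, rfl⟩ : ∃ n, N = n + 1 := ⟨N - 1, by omega⟩
    simp only [Nat.add_sub_cancel]
    rcases n with _ | n
    · simp
    · have e1 : (n + 1 + 1) * (n + 1) / 2 = (n + 1) + (n + 1) * n / 2 := by
        rw [show (n + 1 + 1) * (n + 1) = (n + 1) * n + (n + 1) * 2 by ring, Nat.add_mul_div_right _ _ two_pos]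
        omega
      have e2 : (n + 1) * n / 2 * 2 = (n + 1) * n := by
        apply Nat.div_mul_cancel
        rw [mul_comm]; exact (Nat.even_mul_succ_self n).two_dvd
      rw [e1, show n + 1 + 1 - 2 = n by omega]
      constructor
      · omega
      · nlinarith
  rw [hd1]
  have h4 : PP N m τ y = C / D * (E * qinf q) ^ d *
      Matrix.det (Matrix.of fun j a : Fin N => gS N m a τ (y j)) := by
    apply mul_right_cancel₀ (pow_ne_zero N hA)
    rw [h1, h2, mul_pow, ← pow_mul, hd3, hd2]
    field_simp
    ring
  apply mul_right_cancel₀ hdet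
  rw [h3, h4]
  ring


lemma eta_cast {N : ℕ} (hN : N ≠ 0) {r s : ℝ} (hr : 0 < r) (hs : 0 < s) :
    ((Real.exp (-((N : ℝ) * s) / (24 * r ^ 2)) *
        ∏' n : ℕ, (1 - Real.exp (-(((n : ℝ) + 1) * N * s) / r ^ 2)) : ℝ) : ℂ) =
    Complex.exp (2 * Real.pi * Complex.I * (Complex.I * N * s / (2 * Real.pi * r ^ 2)) / 24) *
      qinf (Complex.exp (2 * Real.pi * Complex.I * (Complex.I * N * s / (2 * Real.pi * r ^ 2)))) := by
  have hr' : (r : ℂ) ≠ 0 := by exact_mod_cast hr.ne'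
  have hp : (Real.pi : ℂ) ≠ 0 := by exact_mod_cast Real.pi_ne_zero
  have e : 2 * Real.pi * Complex.I * (Complex.I * N * s / (2 * Real.pi * r ^ 2)) =
      ((-(N * s) / r ^ 2 : ℝ) : ℂ) := by
    push_cast
    field_simp
    rw [Complex.I_sq]; ring
  have hq := norm_q_lt (im_tau hN hr hs)
  rw [e] at hq ⊢
  rw [← Complex.ofReal_exp] at hq ⊢
  set x := Real.exp (-(N * s) / r ^ 2) with hx
  have hx1 : ‖x‖ < 1 := by simpa using hq
  have hm : Multipliable (fun n : ℕ => (1 - x ^ (n + 1))) := by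
    have : Summable (fun n : ℕ => -(x ^ (n + 1))) := by
      apply Summable.neg
      exact (summable_nat_add_iff 1).mpr (summable_geometric_of_norm_lt_one hx1)
    simpa [sub_eq_add_neg] using Real.multipliable_one_add_of_summable this
  have e2 : ∀ n : ℕ, Real.exp (-(((n : ℝ) + 1) * N * s) / r ^ 2) = x ^ (n + 1) := by
    intro n
    rw [hx, ← Real.exp_nat_mul]; congr 1; push_cast; ring
  simp only [e2]
  rw [Complex.ofReal_mul, qinf]
  congr 1
  · rw [Complex.ofReal_exp]; congr 1; push_cast; ring
  · have := hm.hasProd.map Complex.ofRealHom Complex.continuous_ofReal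
    have h := this.tprod_eq
    rw [Complex.ofRealHom_eq_coe] at h
    rw [← h]
    apply tprod_congr
    intro n
    simp

lemma hA_eq {N : ℕ} (hN : N ≠ 0) {r : ℝ} (hr : 0 < r) (tstar : ℝ) (m : ℤ) :
    ∃ C : ℂ, C ≠ 0 ∧ ∀ s : ℝ, 0 < s → ∀ x : Fin N → ℝ,
      hA N r tstar (Real.pi * r * m) s x = C *
      Matrix.det (Matrix.of fun j a : Fin N => gS N m a (Complex.I * N * s / (2 * Real.pi * r ^ 2))
        ((x j : ℂ) / (2 * Real.pi * r))) := by
  have hr' : (r : ℂ) ≠ 0 := by exact_mod_cast hr.ne'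
  have hp : (Real.pi : ℂ) ≠ 0 := by exact_mod_cast Real.pi_ne_zero
  obtain ⟨C, hC, h⟩ := PP_eq N hN m
  refine ⟨((Real.exp (-((N : ℝ) * ((N : ℝ) - 1) * ((N : ℝ) - 2) * tstar) / (48 * r ^ 2)) : ℝ) : ℂ) * C,
    mul_ne_zero (by rw [Complex.ofReal_exp]; exact Complex.exp_ne_zero _) hC, ?_⟩
  intro s hs x
  unfold hA
  rw [eta_cast hN hr hs]
  have h1 := h _ (im_tau hN hr hs) (fun j => (x j : ℂ) / (2 * Real.pi * r))
  have hη : Complex.exp (2 * Real.pi * Complex.I * (Complex.I * N * s / (2 * Real.pi * r ^ 2)) / 24) *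
      qinf (Complex.exp (2 * Real.pi * Complex.I * (Complex.I * N * s / (2 * Real.pi * r ^ 2)))) ≠ 0 :=
    mul_ne_zero (Complex.exp_ne_zero _) (qinf_ne (norm_q_lt (im_tau hN hr hs)))
  set η := Complex.exp (2 * Real.pi * Complex.I * (Complex.I * N * s / (2 * Real.pi * r ^ 2)) / 24) *
      qinf (Complex.exp (2 * Real.pi * Complex.I * (Complex.I * N * s / (2 * Real.pi * r ^ 2))))
  rw [mul_assoc, mul_assoc]
  have h2 : theta1 ((((Real.pi * r * m + ∑ j, x j) / (2 * Real.pi * r) : ℝ)) : ℂ)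
      (Complex.I * N * s / (2 * Real.pi * r ^ 2)) *
    (∏ j : Fin N, ∏ k : Fin N, if j < k then
      theta1 ((((x k - x j) / (2 * Real.pi * r) : ℝ)) : ℂ)
        (Complex.I * N * s / (2 * Real.pi * r ^ 2)) else 1) =
     PP N m (Complex.I * N * s / (2 * Real.pi * r ^ 2)) (fun j => (x j : ℂ) / (2 * Real.pi * r)) := by
    unfold PP
    congr 1
    · congr 1
      rw [← Finset.sum_div]
      push_cast
      field_simp
    · refine prod_pairs_congr fun j k _ => ?_
      congr 1
      push_cast
      ring
  rw [h2, h1, zpow_neg, zpow_natCast]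
  have := pow_ne_zero ((N - 1) * (N - 2) / 2) hη
  field_simp

theorem stmt_12 (N : ℕ) (hN : 2 ≤ N) (r tstar δ t : ℝ) (hr : 0 < r)
    (hδ : ∃ m : ℤ, δ = Real.pi * r * m) (ht : 0 < t) (htt : t < tstar)
    (u : Fin N → ℝ) (hu0 : ∀ j, 0 ≤ u j) (humono : StrictMono u)
    (hu2 : ∀ j, u j < 2 * Real.pi * r)
    (hubar1 : 0 < δ + ∑ j, u j) (hubar2 : δ + ∑ j, u j < 2 * Real.pi * r)
    (w : Fin N → ℝ) :
    Matrix.det (Matrix.of fun j k : Fin N => MA N r tstar u δ k t (w j)) =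
      hA N r tstar δ (tstar - t) w / hA N r tstar δ tstar u := by
  have hN0 : N ≠ 0 := by omega
  obtain ⟨m, rfl⟩ := hδ
  have hp0 : 0 < 2 * Real.pi * r := by positivity
  have hr' : (r : ℂ) ≠ 0 := by exact_mod_cast hr.ne'
  have hp : (Real.pi : ℂ) ≠ 0 := by exact_mod_cast Real.pi_ne_zero
  have hts : 0 < tstar := ht.trans htt
  have hτ := im_tau hN0 hr hts
  -- expansion of Φ in the basis
  have hex : ∀ k : Fin N, ∃ C : Fin N → ℂ, ∀ z : ℂ, PhiA N r tstar u (Real.pi * r * m) k z =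
      ∑ a, C a * gS N m a (Complex.I * N * tstar / (2 * Real.pi * r ^ 2)) (z / (2 * Real.pi * r)) := by
    intro k
    obtain ⟨C, hC⟩ := theta_prod_basis hτ hN0 m (fun i => (if i = k then (((Real.pi * r * m + ∑ i, u i : ℝ) : ℂ)) else 0) / (2 * Real.pi * r) - (u i : ℂ) / (2 * Real.pi * r)) (by
      rw [Finset.sum_sub_distrib, ← Finset.sum_div, ← Finset.sum_div]
      simp only [Finset.sum_ite_eq', Finset.mem_univ, if_true]
      push_cast
      field_simp
      ring)
    refine ⟨fun a => (theta1 (((Real.pi * r * m + ∑ i, u i : ℝ) : ℂ) / (2 * Real.pi * r))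
      (Complex.I * N * tstar / (2 * Real.pi * r ^ 2)) * ∏ ℓ ∈ Finset.univ.erase k, theta1 ((((u k - u ℓ) : ℝ) : ℂ) / (2 * Real.pi * r))
        (Complex.I * N * tstar / (2 * Real.pi * r ^ 2)))⁻¹ * C a, ?_⟩
    intro z
    simp only [mul_assoc]
    rw [← Finset.mul_sum]
    simp only [← mul_assoc]
    rw [← hC, ← Finset.mul_prod_erase _ _ (Finset.mem_univ k)]
    unfold PhiA
    rw [Finset.prod_div_distrib, div_mul_div_comm, inv_mul_eq_div]
    congr 2
    · congr 1
      rw [if_pos rfl]; ring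
    · apply Finset.prod_congr rfl
      intro l hl
      rw [if_neg (Finset.ne_of_mem_erase hl)]
      congr 1; ring
  choose Cm hCm using hex
  -- the heat flow
  have hM : ∀ k x, MA N r tstar u (Real.pi * r * m) k t x = ∑ a, Cm k a *
      gS N m a (Complex.I * N * ((tstar - t : ℝ) : ℂ) / (2 * Real.pi * r ^ 2)) ((x : ℂ) / (2 * Real.pi * r)) := by
    intro k x
    unfold MA
    simp only [hCm]
    exact heat N hN0 m hr ht htt (Cm k) x
  have hdetM : Matrix.det (Matrix.of fun j k : Fin N => MA N r tstar u (Real.pi * r * m) k t (w j)) =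
      Matrix.det (Matrix.of fun j a : Fin N =>
        gS N m a (Complex.I * N * ((tstar - t : ℝ) : ℂ) / (2 * Real.pi * r ^ 2)) ((w j : ℂ) / (2 * Real.pi * r))) *
      Matrix.det (Matrix.of fun a k => Cm k a) := by
    rw [← Matrix.det_mul]
    congr 1
    ext j k
    rw [Matrix.mul_apply, Matrix.of_apply, hM]
    apply Finset.sum_congr rfl
    intro a _
    simp only [Matrix.of_apply]
    ring
  have hno : ∀ x : ℝ, -(2 * Real.pi * r) < x → x < 2 * Real.pi * r → x ≠ 0 →
      theta1 ((x : ℂ) / (2 * Real.pi * r)) (Complex.I * N * tstar / (2 * Real.pi * r ^ 2)) ≠ 0 := by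
    intro x h1 h2 h3
    have := theta1_ne hτ (x / (2 * Real.pi * r)) (by
      intro n hn
      rw [div_eq_iff hp0.ne'] at hn
      have hn1 : (n : ℝ) < 1 := by
        by_contra hc
        nlinarith [not_lt.mp hc]
      have hn2 : (-1 : ℝ) < n := by
        by_contra hc
        nlinarith [not_lt.mp hc]
      have hn1' : n < 1 := by exact_mod_cast hn1
      have hn2' : -1 < n := by exact_mod_cast hn2
      have : n = 0 := by omega
      rw [this] at hn
      simp at hn
      exact h3 hn)
    push_cast at this
    exact this
  have hPhi : ∀ j k, PhiA N r tstar u (Real.pi * r * m) k (u j) = if j = k then 1 else 0 := by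
    intro j k
    unfold PhiA
    split_ifs with h
    · subst h
      rw [add_sub_cancel_right, div_self (hno _ (by linarith) hubar2 hubar1.ne'), one_mul]
      apply Finset.prod_eq_one
      intro l hl
      rw [← Complex.ofReal_sub, div_self]
      have hne : u j ≠ u l := fun h => Finset.ne_of_mem_erase hl (humono.injective h.symm)
      apply hno
      · linarith [hu0 j, hu2 l]
      · linarith [hu0 l, hu2 j]
      · exact sub_ne_zero.mpr hne
    · rw [Finset.prod_eq_zero (i := j)]
      · simp
      · simp [h]
      · rw [sub_self, zero_div, theta1_zero, zero_div]
  have hone : Matrix.det (Matrix.of fun j a : Fin N =>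
        gS N m a (Complex.I * N * tstar / (2 * Real.pi * r ^ 2)) ((u j : ℂ) / (2 * Real.pi * r))) *
      Matrix.det (Matrix.of fun a k => Cm k a) = 1 := by
    rw [← Matrix.det_mul, ← Matrix.det_one (n := Fin N)]
    congr 1
    ext j k
    rw [Matrix.mul_apply, Matrix.one_apply, ← hPhi, hCm]
    apply Finset.sum_congr rfl
    intro a _
    simp only [Matrix.of_apply]
    ring
  obtain ⟨C, hC, hh⟩ := hA_eq hN0 hr tstar m
  rw [hh _ (sub_pos.mpr htt), hh _ hts, hdetM, mul_div_mul_left _ _ hC, eq_div_iff (left_ne_zero_of_mul_eq_one hone)]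
  rw [mul_assoc, mul_comm (Matrix.det (Matrix.of fun a k => Cm k a)), hone, mul_one]
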